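/- arXiv:2510.10848 — 5 statements merged into one kernel-verified Lean document; each statement's English description precedes it below -/
import Mathlib

section
/- (Skolem–Mahler–Lech) Let (a_n)_{n≥0} be a sequence of complex numbers satisfying a linear recurrence: there exist k ≥ 1 and c_0, ..., c_{k−1} ∈ ℂ such that a_{n+k} = ∑_{i=0}^{k−1} c_i a_{n+i} for all n. Then there exist r ≥ 1, a finite set F ⊆ ℕ, and natural numbers b_1, ..., b_k (with k possibly 0) such that the zero set Z(a_n) = {n ∈ ℕ : a_n = 0} equals F ∪ ⋃_{i=1}^k (b_i + rℕ), where b + rℕ = {b, b+r, b+2r, ...}. -/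
open Polynomial in
theorem norm_coeff_le_of_X_sub_C_mul {L : Type*} [NormedField L] [IsUltrametricDist L]
    {c δ : ℝ} (hc : 0 ≤ c) (hδ0 : 0 ≤ δ) (hδ1 : δ ≤ 1) {z : L} (hz : ‖z‖ ≤ 1) {g : L[X]}
    (hq : ∀ l, ‖((X - C z) * g).coeff l‖ ≤ c * δ ^ l) (l : ℕ) :
    ‖g.coeff l‖ ≤ c * δ * δ ^ l := by
  have key : ∀ n l, g.natDegree < l + n → ‖g.coeff l‖ ≤ c * δ * δ ^ l := by
    intro n
    induction n with
    | zero =>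
      intro l hl
      rw [coeff_eq_zero_of_natDegree_lt (by simpa using hl), norm_zero]
      positivity
    | succ n ih =>
      intro l hl
      have h1 := ih (l + 1) (by omega)
      have h2 := hq (l + 1)
      have h3 : g.coeff l = ((X - C z) * g).coeff (l + 1) + z * g.coeff (l + 1) := by
        rw [sub_mul, coeff_sub, coeff_X_mul, coeff_C_mul]
        ring
      rw [h3]
      refine (IsUltrametricDist.norm_add_le_max _ _).trans (max_le ?_ ?_)
      · exact h2.trans (le_of_eq (by ring))
      · rw [norm_mul]
        calc ‖z‖ * ‖g.coeff (l + 1)‖ ≤ 1 * (c * δ * δ ^ (l + 1)) := by gcongr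
          _ = c * δ * δ ^ l * δ := by ring
          _ ≤ c * δ * δ ^ l := mul_le_of_le_one_right (by positivity) hδ1
  exact key (g.natDegree + 1) l (by omega)

open Polynomial in
/-- A polynomial with geometrically decaying coefficients and many roots in the unit ball of an
ultrametric field is small on the unit ball. -/
theorem norm_eval_le_of_roots {L : Type*} [NormedField L] [IsUltrametricDist L]
    {δ : ℝ} (hδ0 : 0 ≤ δ) (hδ1 : δ ≤ 1) {x : L} (hx : ‖x‖ ≤ 1) (Z : Finset L)
    (hZ : ∀ z ∈ Z, ‖z‖ ≤ 1) {c : ℝ} (hc : 0 ≤ c) {q : L[X]}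
    (hq : ∀ l, ‖q.coeff l‖ ≤ c * δ ^ l) (hroots : ∀ z ∈ Z, q.eval z = 0) :
    ‖q.eval x‖ ≤ c * δ ^ Z.card := by
  classical
  induction Z using Finset.induction_on generalizing c q with
  | empty =>
    rw [eval_eq_sum_range]
    refine IsUltrametricDist.norm_sum_le_of_forall_le_of_nonneg (by simpa using hc) fun i _ => ?_
    rw [norm_mul, norm_pow]
    calc ‖q.coeff i‖ * ‖x‖ ^ i ≤ (c * δ ^ i) * 1 :=
          mul_le_mul (hq i) (pow_le_one₀ (norm_nonneg _) hx) (by positivity) (by positivity)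
      _ ≤ c * 1 * 1 := by gcongr; exact pow_le_one₀ hδ0 hδ1
      _ = _ := by simp
  | insert z Z hz ih =>
    obtain ⟨g, rfl⟩ := dvd_iff_isRoot.mpr (hroots z (Finset.mem_insert_self _ _))
    have hz1 := hZ z (Finset.mem_insert_self _ _)
    have h := ih (fun w hw => hZ w (Finset.mem_insert_of_mem hw)) (mul_nonneg hc hδ0)
      (norm_coeff_le_of_X_sub_C_mul hc hδ0 hδ1 hz1 hq) (fun w hw => by
        have h1 := hroots w (Finset.mem_insert_of_mem hw)
        rw [eval_mul, eval_sub, eval_X, eval_C, mul_eq_zero, sub_eq_zero] at h1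
        exact h1.resolve_left fun e => hz (e ▸ hw))
    rw [eval_mul, eval_sub, eval_X, eval_C, norm_mul, Finset.card_insert_of_notMem hz]
    have hxz : ‖x - z‖ ≤ 1 := by
      rw [sub_eq_add_neg]
      exact (IsUltrametricDist.norm_add_le_max _ _).trans (max_le hx (by rwa [norm_neg]))
    calc ‖x - z‖ * ‖g.eval x‖ ≤ 1 * (c * δ * δ ^ Z.card) := by gcongr
      _ = _ := by ring

theorem norm_inv_factorial_le {p : ℕ} [Fact p.Prime] {L : Type*} [NormedField L]
    [NormedAlgebra ℚ_[p] L] (n : ℕ) : ‖((n.factorial : L))⁻¹‖ ≤ (p : ℝ) ^ n := by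
  have hp1 : (1 : ℝ) ≤ p := by exact_mod_cast (Fact.out : p.Prime).one_lt.le
  rw [norm_inv, ← map_natCast (algebraMap ℚ_[p] L), norm_algebraMap',
    Padic.norm_eq_zpow_neg_valuation (by exact_mod_cast n.factorial_ne_zero),
    Padic.valuation_natCast, zpow_neg, inv_inv, zpow_natCast]
  exact pow_le_pow_right₀ hp1 (padicValNat_factorial_le p n)

theorem norm_coeff_descPochhammer_le {L : Type*} [NormedField L] [IsUltrametricDist L]
    (i l : ℕ) : ‖(descPochhammer L i).coeff l‖ ≤ 1 := by
  rw [← descPochhammer_map (Int.castRingHom L), Polynomial.coeff_map]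
  exact IsUltrametricDist.norm_intCast_le_one L _

open Polynomial in
/-- A binomial series whose coefficients decay fast enough `p`-adically vanishes at all natural
numbers as soon as it vanishes at infinitely many of them. -/
theorem binomial_sum_eq_zero_of_infinite {p : ℕ} [Fact p.Prime] {L : Type*} [NormedField L]
    [NormedAlgebra ℚ_[p] L] [IsUltrametricDist L] {c : ℝ} (hc : 0 ≤ c) {d : ℕ → L}
    (hd : ∀ i, ‖d i‖ ≤ c * (1 / (2 * p)) ^ i)
    (hinf : {n : ℕ | ∑ i ∈ Finset.range (n + 1), (n.choose i : L) * d i = 0}.Infinite) (n : ℕ) :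
    ∑ i ∈ Finset.range (n + 1), (n.choose i : L) * d i = 0 := by
  have : CharZero L := charZero_of_injective_algebraMap (algebraMap ℚ_[p] L).injective
  have hp0 : (0 : ℝ) < p := by exact_mod_cast (Fact.out : p.Prime).pos
  have key : ∀ j : ℕ, ‖∑ i ∈ Finset.range (n + 1), (n.choose i : L) * d i‖ ≤
      c * (1 / 2 : ℝ) ^ j := by
    intro j
    obtain ⟨Z, hZ, hcard⟩ := hinf.exists_subset_card_eq j
    set N := max n (Z.sup id) with hN
    set q : L[X] := ∑ i ∈ Finset.range (N + 1),
      C (d i * ((i.factorial : L))⁻¹) * descPochhammer L i with hqdef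
    have heval : ∀ m ≤ N, q.eval (m : L) =
        ∑ i ∈ Finset.range (m + 1), (m.choose i : L) * d i := by
      intro m hm
      rw [hqdef, eval_finsetSum]
      have : Finset.range (m + 1) ⊆ Finset.range (N + 1) := by
        intro a; simp only [Finset.mem_range]; omega
      rw [Finset.sum_subset (f := fun i => (m.choose i : L) * d i) this]
      · refine Finset.sum_congr rfl fun i _ => ?_
        have hi : (i.factorial : L) ≠ 0 := by exact_mod_cast i.factorial_ne_zero
        rw [eval_mul, eval_C, descPochhammer_eval_eq_descFactorial,
          Nat.descFactorial_eq_factorial_mul_choose]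
        push_cast
        field_simp
      · intro i _ hi
        rw [Nat.choose_eq_zero_of_lt (by simpa using hi)]
        simp
    have hcoeff : ∀ l, ‖q.coeff l‖ ≤ c * (1 / 2 : ℝ) ^ l := by
      intro l
      rw [hqdef, finsetSum_coeff]
      refine IsUltrametricDist.norm_sum_le_of_forall_le_of_nonneg (by positivity) fun i _ => ?_
      rw [coeff_C_mul]
      by_cases hil : i < l
      · rw [coeff_eq_zero_of_natDegree_lt (by rwa [descPochhammer_natDegree]), mul_zero, norm_zero]
        positivity
      · rw [norm_mul, norm_mul]
        calc ‖d i‖ * ‖((i.factorial : L))⁻¹‖ * ‖(descPochhammer L i).coeff l‖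
            ≤ (c * (1 / (2 * p)) ^ i) * (p : ℝ) ^ i * 1 := by
              gcongr
              · exact hd i
              · exact norm_inv_factorial_le i
              · exact norm_coeff_descPochhammer_le i l
          _ = c * (1 / 2 : ℝ) ^ i := by
              rw [mul_one, mul_assoc, ← mul_pow]
              congr 2
              field_simp
          _ ≤ c * (1 / 2 : ℝ) ^ l := by
              gcongr ?_ * ?_
              exact pow_le_pow_of_le_one (by norm_num) (by norm_num) (by omega)
    have h := norm_eval_le_of_roots (by norm_num) (by norm_num)
      (IsUltrametricDist.norm_natCast_le_one L n) (Z.map ⟨Nat.cast, Nat.cast_injective⟩)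
      (by
        intro z hz
        obtain ⟨m, -, rfl⟩ := Finset.mem_map.mp hz
        exact IsUltrametricDist.norm_natCast_le_one L m) hc hcoeff
      (by
        intro z hz
        obtain ⟨m, hm, rfl⟩ := Finset.mem_map.mp hz
        have := Finset.le_sup (f := id) hm
        exact (heval m (by simp only [id] at this; omega)).trans (hZ hm))
    rw [heval n (by omega), Finset.card_map, hcard] at h
    exact h
  have hlim : Filter.Tendsto (fun j : ℕ => c * (1 / 2 : ℝ) ^ j) Filter.atTop (nhds (c * 0)) :=
    (tendsto_pow_atTop_nhds_zero_of_lt_one (by norm_num) (by norm_num)).const_mul c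
  have := ge_of_tendsto' hlim key
  exact norm_le_zero_iff.mp (by simpa using this)

open Polynomial in
theorem norm_coeff_mul_le {L : Type*} [NormedField L] [IsUltrametricDist L] {a b : ℝ}
    (ha : 0 ≤ a) (hb : 0 ≤ b) {P Q : L[X]} (hP : ∀ l, ‖P.coeff l‖ ≤ a)
    (hQ : ∀ l, ‖Q.coeff l‖ ≤ b) (l : ℕ) : ‖(P * Q).coeff l‖ ≤ a * b := by
  rw [coeff_mul]
  refine IsUltrametricDist.norm_sum_le_of_forall_le_of_nonneg (by positivity) fun x _ => ?_
  rw [norm_mul]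
  exact mul_le_mul (hP _) (hQ _) (norm_nonneg _) ha

open Polynomial in
theorem norm_coeff_pow_le {L : Type*} [NormedField L] [IsUltrametricDist L] {a : ℝ}
    (ha : 0 ≤ a) {P : L[X]} (hP : ∀ l, ‖P.coeff l‖ ≤ a) (n l : ℕ) :
    ‖(P ^ n).coeff l‖ ≤ a ^ n := by
  induction n generalizing l with
  | zero =>
    rw [pow_zero, pow_zero, coeff_one]
    split_ifs <;> simp
  | succ n ih =>
    rw [pow_succ, pow_succ]
    exact norm_coeff_mul_le (by positivity) ha ih hP l

/-- The shift operator on sequences. -/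
def seqShift (L : Type*) [Field L] : Module.End L (ℕ → L) := LinearMap.funLeft L L Nat.succ

open Polynomial in
theorem aeval_seqShift_X_pow {L : Type*} [Field L] (u : ℕ → L) (n s : ℕ) :
    aeval (seqShift L) (X ^ n : L[X]) u s = u (s + n) := by
  rw [aeval_X_pow]
  induction n generalizing s with
  | zero => simp
  | succ n ih =>
    rw [pow_succ', Module.End.mul_apply]
    change (seqShift L ^ n) u (s + 1) = _
    rw [ih]
    congr 1
    omega

open Polynomial in
theorem aeval_seqShift_sum {L : Type*} [Field L] (u : ℕ → L) (v : ℕ → L) (k s : ℕ) :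
    aeval (seqShift L) (∑ i ∈ Finset.range k, C (v i) * X ^ i) u s =
      ∑ i ∈ Finset.range k, v i * u (s + i) := by
  rw [map_sum, LinearMap.sum_apply, Finset.sum_apply]
  refine Finset.sum_congr rfl fun i _ => ?_
  rw [map_mul, aeval_C, Module.End.mul_apply, Module.algebraMap_end_apply, Pi.smul_apply,
    aeval_seqShift_X_pow, smul_eq_mul]

open Polynomial in
theorem aeval_seqShift_apply {L : Type*} [Field L] (u : ℕ → L) (P : L[X]) (s : ℕ) :
    aeval (seqShift L) P u s = ∑ i ∈ Finset.range (P.natDegree + 1), P.coeff i * u (s + i) := by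
  rw [← aeval_seqShift_sum, ← P.as_sum_range_C_mul_X_pow]

open Polynomial in
theorem norm_coeff_sum_range_le {L : Type*} [NormedField L] {a : ℝ} (ha : 0 ≤ a) {v : ℕ → L}
    {k : ℕ} (hv : ∀ i < k, ‖v i‖ ≤ a) (l : ℕ) :
    ‖(∑ i ∈ Finset.range k, C (v i) * X ^ i : L[X]).coeff l‖ ≤ a := by
  simp only [finsetSum_coeff, coeff_C_mul_X_pow, Finset.sum_ite_eq, Finset.mem_range]
  split_ifs with h
  · exact hv l h
  · simpa using ha

theorem exists_norm_le_of_recurrence {L : Type*} [NormedField L] [IsUltrametricDist L]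
    {k : ℕ} {c u : ℕ → L} (hc : ∀ i < k, ‖c i‖ ≤ 1)
    (hrec : ∀ n, u (n + k) = ∑ i ∈ Finset.range k, c i * u (n + i)) :
    ∃ B : ℝ, 0 ≤ B ∧ ∀ n, ‖u n‖ ≤ B := by
  have hB : 0 ≤ ∑ i ∈ Finset.range k, ‖u i‖ := Finset.sum_nonneg fun _ _ => norm_nonneg _
  refine ⟨∑ i ∈ Finset.range k, ‖u i‖, hB, fun n => ?_⟩
  induction n using Nat.strong_induction_on with
  | _ n ih =>
    by_cases hn : n < k
    · exact Finset.single_le_sum (f := fun i => ‖u i‖) (fun _ _ => norm_nonneg _)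
        (Finset.mem_range.mpr hn)
    · obtain ⟨m, rfl⟩ := Nat.exists_eq_add_of_le' (not_lt.mp hn)
      rw [hrec]
      refine IsUltrametricDist.norm_sum_le_of_forall_le_of_nonneg hB fun i hi => ?_
      rw [Finset.mem_range] at hi
      rw [norm_mul]
      calc ‖c i‖ * ‖u (m + i)‖ ≤ 1 * ‖u (m + i)‖ := by gcongr; exact hc i hi
        _ ≤ _ := by rw [one_mul]; exact ih _ (by omega)

/-- Every shift of a recurrence sequence is a combination of the first `k` shifts, with
coefficients in the ring generated by those of the recurrence. -/
theorem exists_shift_eq_sum {L : Type*} [Field L] (O : Subring L) {k : ℕ} (hk : 1 ≤ k)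
    {c u : ℕ → L} (hc : ∀ i < k, c i ∈ O)
    (hrec : ∀ n, u (n + k) = ∑ i ∈ Finset.range k, c i * u (n + i)) (n : ℕ) :
    ∃ v : ℕ → L, (∀ i, v i ∈ O) ∧
      ∀ s, u (s + n) = ∑ i ∈ Finset.range k, v i * u (s + i) := by
  obtain ⟨k, rfl⟩ := Nat.exists_eq_add_of_le' hk
  induction n with
  | zero =>
    refine ⟨fun i => if i = 0 then 1 else 0, fun i => ?_, fun s => ?_⟩
    · dsimp only
      split_ifs
      exacts [O.one_mem, O.zero_mem]
    · rw [Finset.sum_range_succ']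
      simp
  | succ n ih =>
    obtain ⟨v, hv, h⟩ := ih
    refine ⟨fun i => if i < k + 1 then (if i = 0 then 0 else v (i - 1)) + v k * c i else 0,
      fun i => ?_, fun s => ?_⟩
    · dsimp only
      split_ifs with h1
      · exact O.add_mem O.zero_mem (O.mul_mem (hv _) (hc _ h1))
      · exact O.add_mem (hv _) (O.mul_mem (hv _) (hc _ h1))
      · exact O.zero_mem
    · have h2 : ∑ i ∈ Finset.range (k + 1), (if i < k + 1 then
          (if i = 0 then 0 else v (i - 1)) + v k * c i else 0) * u (s + i) =
          ∑ i ∈ Finset.range (k + 1), ((if i = 0 then 0 else v (i - 1)) * u (s + i) +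
            v k * (c i * u (s + i))) := by
        refine Finset.sum_congr rfl fun i hi => ?_
        rw [if_pos (Finset.mem_range.mp hi)]
        ring
      rw [h2, Finset.sum_add_distrib, ← Finset.mul_sum, ← hrec, Finset.sum_range_succ',
        show s + (n + 1) = s + 1 + n by omega, h, Finset.sum_range_succ]
      simp only [Nat.add_eq_zero_iff, one_ne_zero, and_false, if_false, Nat.add_sub_cancel,
        if_true, zero_mul, add_zero]
      congr 1
      · exact Finset.sum_congr rfl fun i _ => by rw [show s + 1 + i = s + (i + 1) by omega]
      · rw [show s + 1 + k = s + (k + 1) by omega]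

/-- A sequence of vectors with entries in a compact set has two distinct terms that are close. -/
theorem exists_lt_forall_norm_sub_le {L : Type*} [NormedField L] {S : Set L} (hS : IsCompact S)
    {k : ℕ} {v : ℕ → ℕ → L} (hv : ∀ n i, v n i ∈ S) {ε : ℝ} (hε : 0 < ε) :
    ∃ m n, m < n ∧ ∀ i < k, ‖v n i - v m i‖ ≤ ε := by
  obtain ⟨x, -, φ, hφ, hlim⟩ := (isCompact_univ_pi (X := fun _ : Fin k => L)
    (fun _ => hS)).tendsto_subseq (x := fun n (i : Fin k) => v n i) (fun n i _ => hv n i)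
  obtain ⟨N, hN⟩ := Metric.cauchySeq_iff.mp hlim.cauchySeq ε hε
  refine ⟨φ N, φ (N + 1), hφ (Nat.lt_succ_self N), fun i hi => ?_⟩
  have h := (hN (N + 1) (Nat.le_succ N) N le_rfl).le
  rw [dist_eq_norm] at h
  exact (norm_le_pi_norm _ (⟨i, hi⟩ : Fin k)).trans h

open Polynomial in
theorem exists_period_of_recurrence {L : Type*} [NormedField L] [IsUltrametricDist L]
    (O : Subring L) (hO : ∀ x ∈ O, ‖x‖ ≤ 1) (hcpt : IsCompact (O : Set L)) {k : ℕ} (hk : 1 ≤ k)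
    {c u : ℕ → L} (hc : ∀ i < k, c i ∈ O) (hc0 : c 0 ≠ 0) (hc0' : (c 0)⁻¹ ∈ O)
    (hrec : ∀ n, u (n + k) = ∑ i ∈ Finset.range k, c i * u (n + i)) {ε : ℝ} (hε : 0 < ε) :
    ∃ r, 1 ≤ r ∧ ∃ M : L[X], (∀ l, ‖M.coeff l‖ ≤ ε) ∧
      aeval (seqShift L) (X ^ r : L[X]) u = aeval (seqShift L) (1 + M) u := by
  choose v hv hshift using exists_shift_eq_sum O hk hc hrec
  obtain ⟨m, n, hmn, hclose⟩ := exists_lt_forall_norm_sub_le (k := k) hcpt hv hε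
  obtain ⟨k, rfl⟩ := Nat.exists_eq_add_of_le' hk
  set G : L[X] := ∑ i ∈ Finset.range (k + 1), C (v n i - v m i) * X ^ i with hG
  set h : L[X] := ∑ i ∈ Finset.range (k + 1),
    C ((c 0)⁻¹ * if i = k then 1 else - c (i + 1)) * X ^ i with hh
  have hGu : aeval (seqShift L) (X ^ n : L[X]) u =
      aeval (seqShift L) (X ^ m : L[X]) u + aeval (seqShift L) G u := by
    ext s
    rw [Pi.add_apply, aeval_seqShift_X_pow, aeval_seqShift_X_pow, hG, aeval_seqShift_sum,
      hshift n, hshift m, ← Finset.sum_add_distrib]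
    exact Finset.sum_congr rfl fun i _ => by ring
  have hhu : aeval (seqShift L) (h * X) u = u := by
    ext s
    rw [map_mul, Module.End.mul_apply, hh, aeval_seqShift_sum]
    have hX : ∀ t, aeval (seqShift L) (X : L[X]) u t = u (t + 1) := fun t => by
      simpa using aeval_seqShift_X_pow u 1 t
    simp only [hX]
    have h3 := hrec s
    rw [Finset.sum_range_succ'] at h3
    rw [Finset.sum_range_succ, if_pos rfl, add_assoc s k 1, h3]
    have h4 : ∑ i ∈ Finset.range k, ((c 0)⁻¹ * if i = k then 1 else - c (i + 1)) *
        u (s + i + 1) = -((c 0)⁻¹ * ∑ i ∈ Finset.range k, c (i + 1) * u (s + (i + 1))) := by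
      rw [Finset.mul_sum, ← Finset.sum_neg_distrib]
      refine Finset.sum_congr rfl fun i hi => ?_
      rw [if_neg (Finset.mem_range.mp hi).ne, add_assoc s i 1]
      ring
    rw [h4, add_zero]
    field_simp
    ring
  have hhm : ∀ m, aeval (seqShift L) (h ^ m * X ^ m) u = u := by
    intro m
    induction m with
    | zero => simp
    | succ m ih =>
      rw [show h ^ (m + 1) * X ^ (m + 1) = (h ^ m * X ^ m) * (h * X) by ring, map_mul,
        Module.End.mul_apply, hhu, ih]
  refine ⟨n - m, by omega, h ^ m * G, fun l => ?_, ?_⟩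
  · have h1 := norm_coeff_mul_le (by simp) hε.le (norm_coeff_pow_le zero_le_one
      (norm_coeff_sum_range_le zero_le_one (k := k + 1)
        (v := fun i => (c 0)⁻¹ * if i = k then 1 else - c (i + 1)) fun i hi => hO _ ?_) m)
      (norm_coeff_sum_range_le hε.le hclose) l
    · rwa [one_pow, one_mul] at h1
    · refine O.mul_mem hc0' ?_
      split_ifs with hik
      · exact O.one_mem
      · exact O.neg_mem (hc _ (by omega))
  · calc aeval (seqShift L) (X ^ (n - m) : L[X]) u
        = aeval (seqShift L) (X ^ (n - m)) (aeval (seqShift L) (h ^ m * X ^ m) u) := by rw [hhm]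
      _ = aeval (seqShift L) (h ^ m) (aeval (seqShift L) (X ^ n) u) := by
          rw [← Module.End.mul_apply, ← map_mul, ← Module.End.mul_apply, ← map_mul]
          congr 2
          conv_rhs => rw [← Nat.sub_add_cancel hmn.le, pow_add]
          ring
      _ = aeval (seqShift L) (1 + h ^ m * G) u := by
          rw [hGu, map_add, map_add, ← Module.End.mul_apply, ← map_mul, hhm,
            LinearMap.add_apply, map_one, Module.End.one_apply, map_mul (aeval _),
            Module.End.mul_apply]

open Polynomial in
/-- The Skolem–Mahler–Lech theorem for a recurrence with integral coefficients and invertible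
constant term over a field containing `ℚ_[p]`. -/
theorem exists_period_forall_eq_zero {p : ℕ} [Fact p.Prime] {L : Type*} [NormedField L]
    [NormedAlgebra ℚ_[p] L] [IsUltrametricDist L]
    (O : Subring L) (hO : ∀ x ∈ O, ‖x‖ ≤ 1) (hcpt : IsCompact (O : Set L)) {k : ℕ} (hk : 1 ≤ k)
    {c u : ℕ → L} (hc : ∀ i < k, c i ∈ O) (hc0 : c 0 ≠ 0) (hc0' : (c 0)⁻¹ ∈ O)
    (hrec : ∀ n, u (n + k) = ∑ i ∈ Finset.range k, c i * u (n + i)) :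
    ∃ r, 1 ≤ r ∧ ∀ s, {n | u (s + r * n) = 0}.Infinite → ∀ n, u (s + r * n) = 0 := by
  have hp0 : (0 : ℝ) < p := by exact_mod_cast (Fact.out : p.Prime).pos
  obtain ⟨r, hr, M, hM, hrM⟩ := exists_period_of_recurrence O hO hcpt hk hc hc0 hc0' hrec
    (ε := 1 / (2 * p)) (by positivity)
  obtain ⟨B, hB, hu⟩ := exists_norm_le_of_recurrence (fun i hi => hO _ (hc i hi)) hrec
  have hpow : ∀ n, aeval (seqShift L) (X ^ (r * n) : L[X]) u = aeval (seqShift L) ((1 + M) ^ n) u := by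
    intro n
    induction n with
    | zero => simp
    | succ n ih =>
      rw [mul_add, mul_one, pow_add, map_mul, Module.End.mul_apply, hrM,
        ← Module.End.mul_apply, ← map_mul, mul_comm, map_mul, Module.End.mul_apply, ih,
        ← Module.End.mul_apply, ← map_mul, pow_succ']
  have hsum : ∀ s n, u (s + r * n) = ∑ i ∈ Finset.range (n + 1),
      (n.choose i : L) * aeval (seqShift L) (M ^ i) u s := by
    intro s n
    rw [← aeval_seqShift_X_pow u, hpow, add_comm, add_pow, map_sum, LinearMap.sum_apply,
      Finset.sum_apply]
    refine Finset.sum_congr rfl fun i _ => ?_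
    rw [one_pow, mul_one, mul_comm, map_mul, map_natCast, Module.End.mul_apply,
      Module.End.natCast_apply, Pi.smul_apply, nsmul_eq_mul]
  refine ⟨r, hr, fun s hinf n => ?_⟩
  simp only [hsum] at hinf ⊢
  refine binomial_sum_eq_zero_of_infinite (p := p) hB (fun i => ?_) hinf n
  rw [aeval_seqShift_apply]
  refine IsUltrametricDist.norm_sum_le_of_forall_le_of_nonneg (by positivity) fun j _ => ?_
  rw [norm_mul, mul_comm]
  exact mul_le_mul (hu _) (norm_coeff_pow_le (by positivity) hM i j) (norm_nonneg _) hB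

/-- In an ultrametric field, an element integral over a ring mapping to the unit ball lies in the
unit ball. -/
theorem norm_le_one_of_isIntegralElem {R L : Type*} [CommRing R] [NormedField L]
    [IsUltrametricDist L] {f : R →+* L} (hf : ∀ x, ‖f x‖ ≤ 1) {y : L}
    (hy : f.IsIntegralElem y) : ‖y‖ ≤ 1 := by
  obtain ⟨q, hq, h⟩ := hy
  by_contra! hlt
  have hpos : 0 < ‖y‖ := by linarith
  rw [Polynomial.eval₂_eq_sum_range, Finset.sum_range_succ, hq.coeff_natDegree, map_one,
    one_mul] at h
  rcases Nat.eq_zero_or_pos q.natDegree with h0 | h0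
  · simp [h0] at h
  have h1 : ‖∑ i ∈ Finset.range q.natDegree, f (q.coeff i) * y ^ i‖ ≤
      ‖y‖ ^ (q.natDegree - 1) := by
    refine IsUltrametricDist.norm_sum_le_of_forall_le_of_nonneg (by positivity) fun i hi => ?_
    rw [Finset.mem_range] at hi
    rw [norm_mul, norm_pow]
    calc ‖f (q.coeff i)‖ * ‖y‖ ^ i ≤ 1 * ‖y‖ ^ i := by gcongr; exact hf _
      _ ≤ ‖y‖ ^ (q.natDegree - 1) := by
        rw [one_mul]
        exact pow_le_pow_right₀ hlt.le (by omega)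
  rw [eq_neg_of_add_eq_zero_left h, norm_neg, norm_pow] at h1
  exact absurd h1 (not_le.mpr (pow_lt_pow_right₀ hlt (by omega)))

/-- Values of an integral polynomial at congruent points of the unit ball are congruent. -/
theorem norm_map_le_and_norm_map_sub_lt {ι L : Type*} [NormedField L] [IsUltrametricDist L]
    (n : ι → ℤ) (f : MvPolynomial ι ℤ →+* L) (hf : ∀ i, ‖f (MvPolynomial.X i) - n i‖ < 1)
    (g : MvPolynomial ι ℤ) : ‖f g‖ ≤ 1 ∧ ‖f g - (MvPolynomial.eval n g : ℤ)‖ < 1 := by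
  have hint := IsUltrametricDist.norm_intCast_le_one L
  induction g using MvPolynomial.induction_on with
  | C a => simpa using hint a
  | add g h hg hh =>
    simp only [map_add, Int.cast_add, add_sub_add_comm]
    exact ⟨(IsUltrametricDist.norm_add_le_max _ _).trans (max_le hg.1 hh.1),
      (IsUltrametricDist.norm_add_le_max _ _).trans_lt (max_lt hg.2 hh.2)⟩
  | mul_X g i hg =>
    simp only [map_mul, MvPolynomial.eval_X, Int.cast_mul]
    have hx : ‖f (MvPolynomial.X i)‖ ≤ 1 := by
      rw [← sub_add_cancel (f (MvPolynomial.X i)) (n i : L)]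
      exact (IsUltrametricDist.norm_add_le_max _ _).trans (max_le (hf i).le (hint _))
    refine ⟨by rw [norm_mul]; exact mul_le_one₀ hg.1 (norm_nonneg _) hx, ?_⟩
    rw [show f g * f (MvPolynomial.X i) - (MvPolynomial.eval n g : ℤ) * (n i : L) =
      f g * (f (MvPolynomial.X i) - n i) +
        (f g - (MvPolynomial.eval n g : ℤ)) * (n i : L) by ring]
    refine (IsUltrametricDist.norm_add_le_max _ _).trans_lt (max_lt ?_ ?_)
    · rw [norm_mul]
      exact (mul_le_of_le_one_left (norm_nonneg _) hg.1).trans_lt (hf i)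
    · rw [norm_mul]
      exact (mul_le_of_le_one_right (norm_nonneg _) (hint _)).trans_lt hg.2

/-- Algebraic independence is preserved by invertible affine changes of the coordinates. -/
theorem AlgebraicIndependent.add_mul {ι K A : Type*} [Field K] [CommRing A] [Algebra K A]
    {e : ι → A} (he : AlgebraicIndependent K e) (b c : ι → K) (hc : ∀ i, c i ≠ 0) :
    AlgebraicIndependent K fun i => algebraMap K A (b i) + algebraMap K A (c i) * e i := by
  let φ : MvPolynomial ι K →ₐ[K] MvPolynomial ι K :=
    MvPolynomial.aeval fun i => MvPolynomial.C (b i) + MvPolynomial.C (c i) * MvPolynomial.X i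
  let ψ : MvPolynomial ι K →ₐ[K] MvPolynomial ι K :=
    MvPolynomial.aeval fun i =>
      MvPolynomial.C (c i)⁻¹ * (MvPolynomial.X i - MvPolynomial.C (b i))
  have hψφ : ψ.comp φ = AlgHom.id K _ := by
    ext1 i
    simp only [φ, ψ, AlgHom.comp_apply, MvPolynomial.aeval_X, map_add, map_mul,
      MvPolynomial.algHom_C, AlgHom.id_apply, MvPolynomial.algebraMap_eq]
    rw [← mul_assoc, ← MvPolynomial.C_mul, mul_inv_cancel₀ (hc i)]
    simp
  have hφ : Function.Injective φ :=
    Function.LeftInverse.injective (g := ψ) fun x => DFunLike.congr_fun hψφ x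
  have hcomp : MvPolynomial.aeval (fun i => algebraMap K A (b i) + algebraMap K A (c i) * e i) =
      (MvPolynomial.aeval e).comp φ := by
    ext i
    simp [φ]
  rw [AlgebraicIndependent, hcomp]
  rw [AlgHom.coe_comp]
  exact Function.Injective.comp he hφ

theorem exists_algebraicIndependent_padicAlgCl (p : ℕ) [Fact p.Prime] {ι : Type}
    (hι : Cardinal.mk ι ≤ Cardinal.continuum) :
    ∃ e : ι → PadicAlgCl p, AlgebraicIndependent ℚ e := by
  have hcard : Cardinal.continuum ≤ Cardinal.mk (PadicAlgCl p) :=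
    (continuum_le_cardinal_of_nontriviallyNormedField ℚ_[p]).trans
      (Cardinal.mk_le_of_injective (algebraMap ℚ_[p] (PadicAlgCl p)).injective)
  obtain ⟨s, hs⟩ := exists_isTranscendenceBasis ℚ (PadicAlgCl p)
  have h := IsAlgClosed.cardinal_eq_cardinal_transcendence_basis_of_aleph0_lt _ hs
    Cardinal.mkRat.le (Cardinal.aleph0_lt_continuum.trans_le hcard)
  rw [Cardinal.lift_id, Cardinal.lift_id] at h
  rw [h] at hcard
  obtain ⟨f⟩ := Cardinal.le_def _ _ |>.mp (hι.trans hcard)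
  exact ⟨fun i => (f i : PadicAlgCl p), hs.1.comp f f.injective⟩

/-- Algebraically independent elements of an algebraic closure of `ℚ_[p]` can be chosen in any
prescribed residue classes of integers. -/
theorem exists_algebraicIndependent_intCast_add (p : ℕ) [Fact p.Prime] {ι : Type}
    (hι : Cardinal.mk ι ≤ Cardinal.continuum) (n : ι → ℤ) :
    ∃ t : ι → PadicAlgCl p, (∀ i, ‖t i‖ < 1) ∧
      AlgebraicIndependent ℤ fun i => (n i : PadicAlgCl p) + t i := by
  obtain ⟨e, he⟩ := exists_algebraicIndependent_padicAlgCl p hι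
  have hp1 : ‖(p : PadicAlgCl p)‖ < 1 := by
    rw [← map_natCast (algebraMap ℚ_[p] (PadicAlgCl p)), norm_algebraMap']
    exact Padic.norm_p_lt_one
  have hp0 : (p : ℚ) ≠ 0 := by exact_mod_cast (Fact.out : p.Prime).ne_zero
  have hk : ∀ i, ∃ k : ℕ, ‖(p : PadicAlgCl p) ^ k * e i‖ < 1 := by
    intro i
    obtain ⟨k, hk⟩ := exists_pow_lt_of_lt_one (y := ‖(p : PadicAlgCl p)‖)
      (show 0 < (‖e i‖ + 1)⁻¹ by positivity) hp1
    refine ⟨k, ?_⟩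
    rw [norm_mul, norm_pow]
    calc ‖(p : PadicAlgCl p)‖ ^ k * ‖e i‖ ≤ (‖e i‖ + 1)⁻¹ * ‖e i‖ := by gcongr
      _ < 1 := by
        rw [inv_mul_lt_iff₀ (by positivity)]
        linarith
  choose k hk using hk
  refine ⟨fun i => (p : PadicAlgCl p) ^ k i * e i, hk, ?_⟩
  have h := (he.add_mul (fun i => (n i : ℚ)) (fun i => (p : ℚ) ^ k i)
    fun i => pow_ne_zero _ hp0).restrictScalars (R := ℤ) (by
      simpa using Int.cast_injective)
  simpa using h

/-- Finitely many complex numbers are integral under a suitable embedding of `ℂ` into an algebraic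
closure of some `ℚ_[p]`. -/
theorem exists_embedding_padicAlgCl_norm_le_one (S : Finset ℂ) :
    ∃ (p : ℕ) (_ : Fact p.Prime) (σ : ℂ →+* PadicAlgCl p), ∀ x ∈ S, ‖σ x‖ ≤ 1 := by
  obtain ⟨B, hB⟩ := exists_isTranscendenceBasis ℤ ℂ
  have hBcard : Cardinal.mk B ≤ Cardinal.continuum :=
    (Cardinal.mk_set_le B).trans Cardinal.mk_complex.le
  let _ : Algebra (MvPolynomial B ℤ) ℂ :=
    (MvPolynomial.aeval (Subtype.val : B → ℂ)).toRingHom.toAlgebra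
  have hinj : Function.Injective (algebraMap (MvPolynomial B ℤ) ℂ) := hB.1
  have : FaithfulSMul (MvPolynomial B ℤ) ℂ := (faithfulSMul_iff_algebraMap_injective _ _).mpr hinj
  have : Algebra.IsAlgebraic (MvPolynomial B ℤ) ℂ := by
    have := hB.isAlgebraic
    exact Algebra.IsAlgebraic.of_ringHom_of_comp_eq hB.1.aevalEquiv (RingHom.id ℂ)
      hB.1.aevalEquiv.surjective Function.injective_id rfl
  have hg : ∀ x : ℂ, ∃ g : MvPolynomial B ℤ, g ≠ 0 ∧ IsIntegral (MvPolynomial B ℤ) (g • x) :=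
    fun x => (Algebra.IsAlgebraic.isAlgebraic x).exists_integral_multiple
  choose g hg0 hgint using hg
  have hprod : ∏ x ∈ S, g x ≠ 0 := Finset.prod_ne_zero_iff.mpr fun x _ => hg0 x
  obtain ⟨n, hn⟩ : ∃ n : B → ℤ, MvPolynomial.eval n (∏ x ∈ S, g x) ≠ 0 := by
    by_contra! h
    exact hprod (MvPolynomial.funext fun n => by rw [h n, map_zero])
  rw [map_prod, Finset.prod_ne_zero_iff] at hn
  obtain ⟨p, hpgt, hp⟩ := Nat.exists_infinite_primes (∑ x ∈ S, (MvPolynomial.eval n (g x)).natAbs + 1)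
  have : Fact p.Prime := ⟨hp⟩
  obtain ⟨t, ht, hind⟩ := exists_algebraicIndependent_intCast_add p hBcard n
  let _ : Algebra (MvPolynomial B ℤ) (PadicAlgCl p) :=
    (MvPolynomial.aeval (fun i => (n i : PadicAlgCl p) + t i)).toRingHom.toAlgebra
  have hX : ∀ i, ‖algebraMap (MvPolynomial B ℤ) (PadicAlgCl p) (MvPolynomial.X i) - n i‖ < 1 := by
    intro i
    change ‖MvPolynomial.aeval (fun i => (n i : PadicAlgCl p) + t i) (MvPolynomial.X i) - _‖ < 1
    rw [MvPolynomial.aeval_X, add_sub_cancel_left]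
    exact ht i
  have hcong := norm_map_le_and_norm_map_sub_lt n _ hX
  have : FaithfulSMul (MvPolynomial B ℤ) (PadicAlgCl p) :=
    (faithfulSMul_iff_algebraMap_injective _ _).mpr hind
  let σ : ℂ →ₐ[MvPolynomial B ℤ] PadicAlgCl p := IsAlgClosed.lift
  refine ⟨p, inferInstance, σ.toRingHom, fun x hx => ?_⟩
  change ‖σ x‖ ≤ 1
  have h1 : ‖σ (g x • x)‖ ≤ 1 :=
    norm_le_one_of_isIntegralElem (f := algebraMap (MvPolynomial B ℤ) (PadicAlgCl p))
      (fun y => (hcong y).1) ((hgint x).map σ)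
  have h2 : ‖((MvPolynomial.eval n (g x) : ℤ) : PadicAlgCl p)‖ = 1 := by
    rw [← map_intCast (algebraMap ℚ_[p] (PadicAlgCl p)), norm_algebraMap']
    refine le_antisymm (Padic.norm_int_le_one _) (not_lt.mp fun hlt => ?_)
    rw [Padic.norm_intCast_lt_one_iff] at hlt
    have h3 := Nat.le_of_dvd (Int.natAbs_pos.mpr (hn x hx)) (Int.natCast_dvd.mp hlt)
    have h4 := Finset.single_le_sum (f := fun x => (MvPolynomial.eval n (g x)).natAbs)
      (fun _ _ => Nat.zero_le _) hx
    omega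
  have h5 : ‖algebraMap (MvPolynomial B ℤ) (PadicAlgCl p) (g x)‖ = 1 := by
    obtain ⟨h6, h7⟩ := hcong (g x)
    refine le_antisymm h6 (not_lt.mp fun hlt => ?_)
    have h8 := IsUltrametricDist.norm_add_le_max
      (algebraMap (MvPolynomial B ℤ) (PadicAlgCl p) (g x))
      (-(algebraMap (MvPolynomial B ℤ) (PadicAlgCl p) (g x) - (MvPolynomial.eval n (g x) : ℤ)))
    rw [norm_neg, neg_sub, add_sub_cancel, h2] at h8
    exact absurd (max_lt hlt h7) (not_lt.mpr h8)
  rw [Algebra.smul_def, map_mul, σ.commutes, norm_mul, h5, one_mul] at h1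
  exact h1

/-- The elements of the unit ball lying in the extension generated by finitely many elements of the
unit ball form a compact subring. -/
theorem exists_compact_subring (p : ℕ) [Fact p.Prime] {T : Set (PadicAlgCl p)} (hT : T.Finite)
    (hT1 : ∀ x ∈ T, ‖x‖ ≤ 1) :
    ∃ O : Subring (PadicAlgCl p), T ⊆ O ∧ (∀ x ∈ O, ‖x‖ ≤ 1) ∧
      IsCompact (O : Set (PadicAlgCl p)) := by
  let E := IntermediateField.adjoin ℚ_[p] T
  have hfin : FiniteDimensional ℚ_[p] E :=
    have := hT.to_subtype
    IntermediateField.finiteDimensional_adjoin fun x _ =>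
      (PadicAlgCl.isAlgebraic p).isAlgebraic x |>.isIntegral
  let V : Submodule ℚ_[p] (PadicAlgCl p) := Subalgebra.toSubmodule E.toSubalgebra
  have hfinV : FiniteDimensional ℚ_[p] V := hfin
  have hproper : ProperSpace V := FiniteDimensional.proper ℚ_[p] V
  let O : Subring (PadicAlgCl p) :=
    { carrier := {x | x ∈ E ∧ ‖x‖ ≤ 1}
      zero_mem' := ⟨E.zero_mem, by simp⟩
      one_mem' := ⟨E.one_mem, by simp⟩
      add_mem' := fun {x y} hx hy => ⟨E.add_mem hx.1 hy.1,
        (IsUltrametricDist.norm_add_le_max x y).trans (max_le hx.2 hy.2)⟩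
      neg_mem' := fun {x} hx => ⟨E.neg_mem hx.1, by rw [norm_neg]; exact hx.2⟩
      mul_mem' := fun {x y} hx hy => ⟨E.mul_mem hx.1 hy.1, by
        rw [norm_mul]; exact mul_le_one₀ hx.2 (norm_nonneg _) hy.2⟩ }
  refine ⟨O, fun x hx => ⟨IntermediateField.subset_adjoin _ _ hx, hT1 x hx⟩,
    fun x hx => hx.2, ?_⟩
  have himage : (O : Set (PadicAlgCl p)) = Set.image Subtype.val (Metric.closedBall (0 : V) 1) := by
    ext x
    constructor
    · rintro ⟨hx, hx1⟩
      exact ⟨⟨x, hx⟩, by rw [mem_closedBall_zero_iff]; exact hx1, rfl⟩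
    · rintro ⟨y, hy, rfl⟩
      rw [mem_closedBall_zero_iff] at hy
      exact ⟨y.2, hy⟩
  rw [himage]
  exact (isCompact_closedBall _ _).image continuous_subtype_val

/-- The zero set of a complex recurrence sequence with nonzero constant term is, along each class
of a suitable modulus, finite or everything. -/
theorem exists_period_forall_eq_zero_complex {k : ℕ} (hk : 1 ≤ k) {a c : ℕ → ℂ} (hc0 : c 0 ≠ 0)
    (hrec : ∀ n, a (n + k) = ∑ i ∈ Finset.range k, c i * a (n + i)) :
    ∃ r, 1 ≤ r ∧ ∀ s, {n | a (s + r * n) = 0}.Infinite → ∀ n, a (s + r * n) = 0 := by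
  classical
  let S : Finset ℂ := insert (c 0)⁻¹ ((Finset.range k).image c)
  obtain ⟨p, hp, σ, hσ⟩ := exists_embedding_padicAlgCl_norm_le_one S
  obtain ⟨O, hTO, hO, hcpt⟩ := exists_compact_subring p (S.finite_toSet.image σ) (by
    rintro _ ⟨x, hx, rfl⟩
    exact hσ x hx)
  have h := exists_period_forall_eq_zero (p := p) O hO hcpt hk (c := fun i => σ (c i))
    (u := fun n => σ (a n))
    (fun i hi => hTO ⟨c i, Finset.mem_insert_of_mem
      (Finset.mem_image_of_mem c (Finset.mem_range.mpr hi)), rfl⟩)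
    (by simpa using hc0) (hTO ⟨_, Finset.mem_insert_self _ _, map_inv₀ σ _⟩)
    (fun n => by simp only [hrec, map_sum, map_mul])
  simpa only [map_eq_zero] using h

/-- The zero set of a complex recurrence sequence is eventually periodic. -/
theorem exists_eventually_periodic (k : ℕ) (a c : ℕ → ℂ)
    (hrec : ∀ n, a (n + k) = ∑ i ∈ Finset.range k, c i * a (n + i)) :
    ∃ r, 1 ≤ r ∧ ∃ N, ∀ n ≥ N, (a n = 0 ↔ a (n + r) = 0) := by
  induction k generalizing a c with
  | zero =>
    have h : ∀ n, a n = 0 := by simpa using hrec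
    exact ⟨1, le_rfl, 0, fun n _ => by simp [h]⟩
  | succ k ih =>
    by_cases hc0 : c 0 = 0
    · obtain ⟨r, hr, N, hN⟩ := ih (fun n => a (n + 1)) (fun i => c (i + 1)) fun n => by
        rw [add_assoc, hrec, Finset.sum_range_succ', hc0, zero_mul, add_zero]
        rfl
      refine ⟨r, hr, N + 1, fun n hn => ?_⟩
      obtain ⟨m, rfl⟩ := Nat.exists_eq_add_of_le' (le_of_add_le_right hn)
      rw [hN m (by omega), add_right_comm]
    · obtain ⟨r, hr, h⟩ := exists_period_forall_eq_zero_complex (by omega) hc0 hrec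
      have hbound : ∀ s, ∃ N, ∀ n ≥ N, (a (s + r * n) = 0 ↔ a (s + r * (n + 1)) = 0) := by
        intro s
        by_cases hinf : {n | a (s + r * n) = 0}.Infinite
        · exact ⟨0, fun n _ => by simp [h s hinf]⟩
        · obtain ⟨N, hN⟩ := (Set.not_infinite.mp hinf).bddAbove
          refine ⟨N + 1, fun n hn => iff_of_false (fun h0 => ?_) fun h0 => ?_⟩
          · have := hN h0
            omega
          · have := hN h0
            omega
      choose N hN using hbound
      refine ⟨r, hr, r * ((Finset.range r).sup N) + r, fun n hn => ?_⟩
      have hlt := Nat.mod_lt n hr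
      have h1 := Finset.le_sup (f := N) (Finset.mem_range.mpr hlt)
      have h2 := Nat.mod_add_div n r
      have h3 : (Finset.range r).sup N ≤ n / r := by
        rw [Nat.le_div_iff_mul_le hr, mul_comm]
        omega
      have h4 := hN (n % r) (n / r) (h1.trans h3)
      rwa [mul_add, mul_one, ← add_assoc, h2] at h4

/-- (Skolem–Mahler–Lech) The zero set of a linear recurrence sequence over `ℂ` is the
union of a finite set and finitely many full arithmetic progressions. -/
theorem skolem_mahler_lech (a : ℕ → ℂ) (k : ℕ) (hk : 1 ≤ k) (c : ℕ → ℂ)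
    (hrec : ∀ n : ℕ, a (n + k) = ∑ i ∈ Finset.range k, c i * a (n + i)) :
    ∃ r : ℕ, 1 ≤ r ∧ ∃ (F : Finset ℕ) (K : ℕ) (b : Fin K → ℕ),
      {n : ℕ | a n = 0} = ↑F ∪ ⋃ i : Fin K, {m : ℕ | ∃ j : ℕ, m = b i + r * j} := by
  classical
  obtain ⟨r, hr, N, hN⟩ := exists_eventually_periodic k a c hrec
  have hper : ∀ n ≥ N, ∀ j, (a n = 0 ↔ a (n + r * j) = 0) := by
    intro n hn j
    induction j with
    | zero => simp
    | succ j ih => rw [ih, hN _ (by omega), mul_add, mul_one, add_assoc]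
  let P : Finset ℕ := {n ∈ Finset.Ico N (N + r) | a n = 0}
  refine ⟨r, hr, {n ∈ Finset.range N | a n = 0}, P.card, fun i => P.equivFin.symm i, ?_⟩
  ext n
  simp only [Set.mem_ofPred_eq, Set.mem_union, Finset.mem_coe, Finset.mem_filter,
    Finset.mem_range, Set.mem_iUnion]
  constructor
  · intro h0
    by_cases hn : n < N
    · exact Or.inl ⟨hn, h0⟩
    · have h1 : N + (n - N) % r + r * ((n - N) / r) = n := by
        rw [add_assoc, Nat.mod_add_div]
        omega
      have h2 : N + (n - N) % r ∈ P := by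
        refine Finset.mem_filter.mpr ⟨Finset.mem_Ico.mpr ⟨by omega, ?_⟩, ?_⟩
        · have := Nat.mod_lt (n - N) hr
          omega
        · rwa [hper _ (by omega) ((n - N) / r), h1]
      refine Or.inr ⟨P.equivFin ⟨_, h2⟩, (n - N) / r, ?_⟩
      rw [Equiv.symm_apply_apply, h1]
  · rintro (h | ⟨i, j, rfl⟩)
    · exact h.2
    · have h1 := Finset.mem_filter.mp (P.equivFin.symm i).2
      exact (hper _ (Finset.mem_Ico.mp h1.1).1 j).mp h1.2
end

section
/- Let r ≥ 1 and let C ⊆ {1, 2, ..., r} satisfy the following closure property: for every i ∈ C and every j ∈ {1, ..., r}, if there exists a ∈ ℕ with a·i ≡ j (mod r), then j ∈ C. Then {m ∈ ℕ : m ≥ 1 and m ≡ i (mod r) for some i ∈ C} = ⋃_{i ∈ C} {i·k : k ∈ ℕ, k ≥ 1}; that is, the union over C of the positive integers congruent to i modulo r equals the union over C of the sets of positive multiples of i. -/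
/-- Bézout's identity modulo `r`, with a positive coefficient. -/
theorem exists_pos_mul_modEq_gcd (i r : ℕ) (hr : 0 < r) :
    ∃ a : ℕ, 0 < a ∧ a * i ≡ Nat.gcd i r [MOD r] := by
  have hr' : (0 : ℤ) < r := by exact_mod_cast hr
  refine ⟨(Nat.gcdA i r % r).toNat + r, by omega, ?_⟩
  rw [← Int.natCast_modEq_iff, Nat.gcd_eq_gcd_ab]
  push_cast
  rw [Int.toNat_of_nonneg (Int.emod_nonneg _ hr'.ne')]
  apply Int.modEq_of_dvd
  refine ⟨i * (Nat.gcdA i r / r) + Nat.gcdB i r - i, ?_⟩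
  linear_combination (-(i : ℤ)) * Int.mul_ediv_add_emod (Nat.gcdA i r) r

/-- Every positive integer has a representative modulo `r` in `{1, ..., r}`. -/
theorem exists_mem_Icc_modEq (m r : ℕ) (hm : 1 ≤ m) (hr : 0 < r) :
    ∃ j ∈ Set.Icc 1 r, m ≡ j [MOD r] := by
  refine ⟨(m - 1) % r + 1, ⟨by omega, Nat.mod_lt _ hr⟩, ?_⟩
  have h := (Nat.mod_modEq (m - 1) r).symm.add_right 1
  rwa [Nat.sub_add_cancel hm] at h

/-- If `C ⊆ {1, ..., r}` is closed under "multiplicative reachability mod `r`", then the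
positive integers congruent mod `r` to some element of `C` are exactly the positive
multiples of elements of `C`. -/
theorem congruence_classes_eq_multiples (r : ℕ) (hr : 1 ≤ r) (C : Set ℕ)
    (hC : C ⊆ Set.Icc 1 r)
    (hclosed : ∀ i ∈ C, ∀ j ∈ Set.Icc 1 r,
      (∃ a : ℕ, 0 < a ∧ a * i ≡ j [MOD r]) → j ∈ C) :
    {m : ℕ | 1 ≤ m ∧ ∃ i ∈ C, m ≡ i [MOD r]} =
      ⋃ i ∈ C, {m : ℕ | ∃ k : ℕ, 1 ≤ k ∧ m = i * k} := by
  ext m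
  simp only [Set.mem_ofPred_eq, Set.mem_iUnion, exists_prop]
  constructor
  · rintro ⟨hm, i, hi, hmi⟩
    have hg : Nat.gcd i r ∣ m := hmi.gcd_eq ▸ Nat.gcd_dvd_left m r
    obtain ⟨k, hk⟩ := hg
    have hgC : Nat.gcd i r ∈ C :=
      hclosed i hi _ ⟨Nat.gcd_pos_of_pos_right i hr, Nat.gcd_le_right i hr⟩
        (exists_pos_mul_modEq_gcd i r hr)
    refine ⟨Nat.gcd i r, hgC, k, Nat.one_le_iff_ne_zero.mpr ?_, hk⟩
    rintro rfl
    simp at hk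
    omega
  · rintro ⟨i, hi, k, hk, rfl⟩
    have hpos : 1 ≤ i * k := Nat.mul_pos (hC hi).1 hk
    obtain ⟨j, hj, hmod⟩ := exists_mem_Icc_modEq (i * k) r hpos hr
    exact ⟨hpos, j, hclosed i hi j hj ⟨k, hk, mul_comm i k ▸ hmod⟩, hmod⟩
end

section
/- Let A be a finite alphabet, X ⊆ A^ℤ an irreducible (topologically transitive) one-step SFT, (Ω, f) a dynamical system with Ω a compact metric space and f : Ω → Ω continuous, and let π : X → Ω be a bounded-to-one factor map, i.e., a continuous surjection with π∘σ = f∘π and sup_{w∈Ω} |π^{−1}(w)| ≤ M for some M ∈ ℕ. Then (Ω, f) is entropy-minimal: for every closed f-invariant proper subset Z ⊊ Ω, the topological entropy satisfies h(f|_Z) < h(f). -/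
/-- The shift map on the full shift `A^ℤ`: `(σ x) i = x (i+1)`. -/
def shiftMap {A : Type*} : (ℤ → A) → (ℤ → A) := fun x i => x (i + 1)

/-- A one-step shift of finite type: the set of bi-infinite sequences all of whose
adjacent pairs lie in a relation `R ⊆ A × A`. -/
def IsOneStepSFT {A : Type*} (X : Set (ℤ → A)) : Prop :=
  ∃ R : Set (A × A), X = {x | ∀ i : ℤ, (x i, x (i + 1)) ∈ R}

/-- Topological transitivity of the shift restricted to a subset `X` of the full shift:
for all open `U, V` meeting `X` there is `n > 0` and a point of `X` in `U` whose
`n`-th shift lies in `V`. -/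
def TransitiveOn {A : Type*} [TopologicalSpace A] (X : Set (ℤ → A)) : Prop :=
  ∀ U V : Set (ℤ → A), IsOpen U → IsOpen V → (U ∩ X).Nonempty → (V ∩ X).Nonempty →
    ∃ n : ℕ, 0 < n ∧ ∃ x ∈ X, x ∈ U ∧ shiftMap^[n] x ∈ V

/-- `E` is `(n, ε)`-separated for `f`. -/
def IsSeparatedSet {Ω : Type*} [PseudoMetricSpace Ω] (f : Ω → Ω) (n : ℕ) (ε : ℝ)
    (E : Set Ω) : Prop :=
  ∀ x ∈ E, ∀ y ∈ E, x ≠ y → ∃ i, i < n ∧ ε < dist (f^[i] x) (f^[i] y)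

/-- The maximal cardinality of an `(n, ε)`-separated set for `f`. -/
noncomputable def sepNum {Ω : Type*} [PseudoMetricSpace Ω] (f : Ω → Ω) (n : ℕ) (ε : ℝ) : ℕ :=
  sSup {k : ℕ | ∃ E : Finset Ω, IsSeparatedSet f n ε ↑E ∧ E.card = k}

/-- Bowen's topological entropy via separated sets:
`h(f) = lim_{ε → 0⁺} limsup_n (1/n) log s_n(ε)`; since the inner quantity is
monotone in `ε`, the limit equals the supremum over `ε > 0`. -/
noncomputable def topEntropy {Ω : Type*} [PseudoMetricSpace Ω] (f : Ω → Ω) : EReal :=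
  ⨆ (ε : ℝ) (_ : 0 < ε),
    Filter.atTop.limsup (fun n : ℕ => ((Real.log (sepNum f n ε) / n : ℝ) : EReal))

theorem getLastD_append_eq {A : Type*} (p q : List A) (a : A) :
    (p ++ q).getLastD a = q.getLastD (p.getLastD a) := by
  induction p generalizing a with
  | nil => rfl
  | cons b p ih => rw [List.cons_append, List.getLastD_cons, List.getLastD_cons, ih]

section PathCounting

variable {A : Type*} [Fintype A]

open Classical in
/-- The lists `l` of length `n` such that `a :: l` is a path for the relation `r`. -/
noncomputable def pathsFrom (r : A → A → Prop) : ℕ → A → Finset (List A)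
  | 0, _ => {[]}
  | n + 1, a => (Finset.univ.filter (r a)).biUnion
      fun b => (pathsFrom r n b).image (List.cons b)

theorem mem_pathsFrom_succ {r : A → A → Prop} {n : ℕ} {a : A} {l : List A} :
    l ∈ pathsFrom r (n + 1) a ↔ ∃ b, r a b ∧ ∃ q ∈ pathsFrom r n b, b :: q = l := by
  simp [pathsFrom]

open Classical in
theorem sum_pathsFrom_succ (r : A → A → Prop) (n : ℕ) (a : A) (g : List A → ℝ) :
    ∑ l ∈ pathsFrom r (n + 1) a, g l =
      ∑ b ∈ Finset.univ.filter (r a), ∑ l ∈ pathsFrom r n b, g (b :: l) := by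
  rw [pathsFrom, Finset.sum_biUnion]
  · refine Finset.sum_congr rfl fun b _ => ?_
    rw [Finset.sum_image]
    intro x _ y _ h
    exact List.cons_injective h
  · intro b _ c _ hbc
    rw [Function.onFun, Finset.disjoint_left]
    intro l hl hl'
    obtain ⟨p, _, rfl⟩ := Finset.mem_image.1 hl
    obtain ⟨q, _, hq⟩ := Finset.mem_image.1 hl'
    exact hbc (List.cons.inj hq).1.symm

theorem append_mem_pathsFrom {r : A → A → Prop} {m n : ℕ} {a : A} {p q : List A}
    (hp : p ∈ pathsFrom r m a) (hq : q ∈ pathsFrom r n (p.getLastD a)) :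
    p ++ q ∈ pathsFrom r (m + n) a := by
  induction m generalizing a p with
  | zero =>
    obtain rfl : p = [] := by simpa [pathsFrom] using hp
    simpa using hq
  | succ m ih =>
    obtain ⟨b, hb, p, hp', rfl⟩ := mem_pathsFrom_succ.1 hp
    rw [Nat.add_right_comm, mem_pathsFrom_succ]
    exact ⟨b, hb, p ++ q, ih hp' (by rwa [List.getLastD_cons] at hq), rfl⟩

theorem getLastD_mem_of_mem_pathsFrom {r : A → A → Prop} {S : Set A}
    (hS : ∀ a ∈ S, ∀ b, r a b → b ∈ S) {n : ℕ} {a : A} (ha : a ∈ S) {p : List A}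
    (hp : p ∈ pathsFrom r n a) : p.getLastD a ∈ S := by
  induction n generalizing a p with
  | zero =>
    obtain rfl : p = [] := by simpa [pathsFrom] using hp
    simpa using ha
  | succ n ih =>
    obtain ⟨b, hb, p, hp', rfl⟩ := mem_pathsFrom_succ.1 hp
    rw [List.getLastD_cons]
    exact ih (hS a ha b hb) hp'

/-- A loop can be traversed repeatedly. -/
theorem exists_loop_mul {r : A → A → Prop} {n : ℕ} {a : A} {u p : List A}
    (hp : p ∈ pathsFrom r n a) (hlast : p.getLastD a = a) (hu : u <:+: p) (k : ℕ) :
    ∃ q ∈ pathsFrom r (n * (k + 1)) a, q.getLastD a = a ∧ u <:+: q := by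
  induction k with
  | zero => exact ⟨p, by simpa using hp, hlast, hu⟩
  | succ k ih =>
    obtain ⟨q, hq, hqlast, hqu⟩ := ih
    refine ⟨q ++ p, ?_, ?_, hqu.trans (List.prefix_append q p).isInfix⟩
    · rw [show n * (k + 1 + 1) = n * (k + 1) + n by ring]
      exact append_mem_pathsFrom hq (by rwa [hqlast])
    · rw [getLastD_append_eq, hqlast, hlast]

open Classical in
/-- Concatenations of `K` paths of length `L`, each of them satisfying `good`. -/
noncomputable def blockPaths (r : A → A → Prop) (good : List A → Prop) (L : ℕ) :
    ℕ → A → Finset (List A)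
  | 0, _ => {[]}
  | K + 1, a => ((pathsFrom r L a).filter good).biUnion
      fun p => (blockPaths r good L K (p.getLastD a)).image (p ++ ·)

section Growth

variable {r : A → A → Prop} {S : Set A} {φ : A → ℝ} {μ : ℝ}

open Classical in
theorem sum_pathsFrom_getLastD_le
    (hS : ∀ a ∈ S, ∀ b, r a b → b ∈ S) (hμ : 0 < μ)
    (hφ : ∀ a ∈ S, ∑ b ∈ Finset.univ.filter (r a), φ b ≤ μ * φ a) (n : ℕ) {a : A} (ha : a ∈ S) :
    ∑ p ∈ pathsFrom r n a, φ (p.getLastD a) ≤ μ ^ n * φ a := by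
  induction n generalizing a with
  | zero => simp [pathsFrom]
  | succ n ih =>
    rw [sum_pathsFrom_succ]
    calc ∑ b ∈ Finset.univ.filter (r a), ∑ l ∈ pathsFrom r n b, φ ((b :: l).getLastD a)
        ≤ ∑ b ∈ Finset.univ.filter (r a), μ ^ n * φ b := by
          refine Finset.sum_le_sum fun b hb => ?_
          simp only [List.getLastD_cons]
          exact ih (hS a ha b (by simpa using hb))
      _ = μ ^ n * ∑ b ∈ Finset.univ.filter (r a), φ b := by rw [Finset.mul_sum]
      _ ≤ μ ^ n * (μ * φ a) := by gcongr; exact hφ a ha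
      _ = μ ^ (n + 1) * φ a := by ring

open Classical in
theorem card_blockPaths_le
    (hS : ∀ a ∈ S, ∀ b, r a b → b ∈ S) (hμ : 0 < μ)
    (hφ : ∀ a ∈ S, ∑ b ∈ Finset.univ.filter (r a), φ b ≤ μ * φ a)
    (hφ1 : ∀ a ∈ S, 1 ≤ φ a) {good : List A → Prop} {L : ℕ}
    (hloop : ∀ a ∈ S, ∃ c ∈ pathsFrom r L a, ¬ good c ∧ c.getLastD a = a)
    (K : ℕ) {a : A} (ha : a ∈ S) :
    ((blockPaths r good L K a).card : ℝ) ≤ (μ ^ L - 1) ^ K * φ a := by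
  have hgood : ∀ a ∈ S, ∑ p ∈ (pathsFrom r L a).filter good, φ (p.getLastD a) ≤
      (μ ^ L - 1) * φ a := by
    intro a ha
    obtain ⟨c, hc, hcg, hca⟩ := hloop a ha
    have h := sum_pathsFrom_getLastD_le hS hμ hφ L ha
    rw [← Finset.sum_filter_add_sum_filter_not _ good] at h
    have h2 : φ a ≤ ∑ p ∈ (pathsFrom r L a).filter (¬ good ·), φ (p.getLastD a) := by
      have h3 := Finset.single_le_sum (f := fun p => φ (p.getLastD a))
        (s := (pathsFrom r L a).filter (¬ good ·))
        (fun p hp => zero_le_one.trans (hφ1 _ (getLastD_mem_of_mem_pathsFrom hS ha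
          (Finset.mem_filter.1 hp).1))) (Finset.mem_filter.2 ⟨hc, hcg⟩)
      rwa [hca] at h3
    linarith
  have hρ : 0 ≤ μ ^ L - 1 := by
    have h := hgood a ha
    have h0 : 0 ≤ ∑ p ∈ (pathsFrom r L a).filter good, φ (p.getLastD a) :=
      Finset.sum_nonneg fun p hp => zero_le_one.trans (hφ1 _ (getLastD_mem_of_mem_pathsFrom hS ha
          (Finset.mem_filter.1 hp).1))
    exact nonneg_of_mul_nonneg_left (h0.trans h) (zero_lt_one.trans_le (hφ1 a ha))
  induction K generalizing a with
  | zero => simpa [blockPaths] using hφ1 a ha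
  | succ K ih =>
    calc ((blockPaths r good L (K + 1) a).card : ℝ)
        ≤ ∑ p ∈ (pathsFrom r L a).filter good,
            ((blockPaths r good L K (p.getLastD a)).card : ℝ) := by
          rw [blockPaths]
          exact_mod_cast Finset.card_biUnion_le.trans
            (Finset.sum_le_sum fun p _ => Finset.card_image_le)
      _ ≤ ∑ p ∈ (pathsFrom r L a).filter good, (μ ^ L - 1) ^ K * φ (p.getLastD a) :=
          Finset.sum_le_sum fun p hp => ih (getLastD_mem_of_mem_pathsFrom hS ha
            (Finset.mem_filter.1 hp).1)
      _ = (μ ^ L - 1) ^ K * ∑ p ∈ (pathsFrom r L a).filter good, φ (p.getLastD a) := by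
          rw [Finset.mul_sum]
      _ ≤ (μ ^ L - 1) ^ K * ((μ ^ L - 1) * φ a) := by gcongr; exact hgood a ha
      _ = (μ ^ L - 1) ^ (K + 1) * φ a := by ring

open Classical in
/-- If the number of paths grows at rate less than `μ`, there is a positive function which is
superharmonic with multiplier `μ`. -/
theorem exists_superharmonic
    (hS : ∀ a ∈ S, ∀ b, r a b → b ∈ S) {C ν : ℝ} (hν : 0 < ν) (hνμ : ν < μ)
    (hN : ∀ a ∈ S, ∀ n, ((pathsFrom r n a).card : ℝ) ≤ C * ν ^ n) :
    ∃ φ : A → ℝ, (∀ a ∈ S, ∑ b ∈ Finset.univ.filter (r a), φ b ≤ μ * φ a) ∧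
      ∀ a ∈ S, 1 ≤ φ a := by
  have hμ : 0 < μ := hν.trans hνμ
  set g : A → ℕ → ℝ := fun a n => (pathsFrom r n a).card / μ ^ n with hg
  have hsum : ∀ a ∈ S, Summable (g a) := by
    intro a ha
    refine Summable.of_nonneg_of_le (fun n => by positivity) (fun n => ?_)
      ((summable_geometric_of_lt_one (r := ν / μ) (by positivity)
        ((div_lt_one hμ).2 hνμ)).mul_left C)
    rw [div_pow, ← mul_div_assoc]
    exact div_le_div_of_nonneg_right (hN a ha n) (by positivity)
  have hrec : ∀ a ∈ S, ∑' n, g a n = 1 + μ⁻¹ * ∑ b ∈ Finset.univ.filter (r a), ∑' n, g b n := by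
    intro a ha
    rw [(hsum a ha).tsum_eq_zero_add, ← Summable.tsum_finsetSum, ← tsum_mul_left]
    · congr 1
      · simp [hg, pathsFrom]
      · refine tsum_congr fun n => ?_
        have h : ((pathsFrom r (n + 1) a).card : ℝ) =
            ∑ b ∈ Finset.univ.filter (r a), ((pathsFrom r n b).card : ℝ) := by
          simpa using sum_pathsFrom_succ r n a fun _ => 1
        simp only [hg]
        rw [h, ← Finset.sum_div, pow_succ, div_mul_eq_div_div, div_eq_inv_mul]
    · exact fun b hb => hsum b (hS a ha b (by simpa using hb))
  refine ⟨fun a => ∑' n, g a n, fun a ha => ?_, fun a ha => ?_⟩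
  · simp only [hrec a ha]
    rw [mul_add, mul_inv_cancel_left₀ hμ.ne']
    linarith
  · simp only [hrec a ha]
    have : 0 ≤ μ⁻¹ * ∑ b ∈ Finset.univ.filter (r a), ∑' n, g b n :=
      mul_nonneg (by positivity) (Finset.sum_nonneg fun b _ => tsum_nonneg fun n => by positivity)
    linarith

end Growth

end PathCounting

section Windows

variable {A : Type*}

/-- The word of length `n` read in `x` from position `i` on. -/
def window (x : ℤ → A) : ℤ → ℕ → List A
  | _, 0 => []
  | i, n + 1 => x i :: window x (i + 1) n

theorem length_window (x : ℤ → A) (i : ℤ) (n : ℕ) : (window x i n).length = n := by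
  induction n generalizing i with
  | zero => rfl
  | succ n ih => simp [window, ih]

theorem window_add (x : ℤ → A) (i : ℤ) (m n : ℕ) :
    window x i (m + n) = window x i m ++ window x (i + m) n := by
  induction m generalizing i with
  | zero => simp [window]
  | succ m ih =>
    rw [Nat.add_right_comm, window, window, ih, List.cons_append]
    congr 3
    push_cast
    ring

theorem window_eq_iff {x y : ℤ → A} {i j : ℤ} {n : ℕ} :
    window x i n = window y j n ↔ ∀ k : ℕ, k < n → x (i + k) = y (j + k) := by
  induction n generalizing i j with
  | zero => simp [window]
  | succ n ih =>
    rw [window, window, List.cons.injEq, ih]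
    constructor
    · rintro ⟨h0, h⟩ k hk
      rcases k with _ | k
      · simpa using h0
      · have := h k (by omega)
        push_cast
        rwa [add_comm (k : ℤ) 1, ← add_assoc, ← add_assoc]
    · intro h
      refine ⟨by simpa using h 0 (by omega), fun k hk => ?_⟩
      have := h (k + 1) (by omega)
      push_cast at this
      rwa [add_comm (k : ℤ) 1, ← add_assoc, ← add_assoc] at this

theorem iterate_shiftMap_apply (x : ℤ → A) (n : ℕ) (i : ℤ) : shiftMap^[n] x i = x (i + n) := by
  induction n generalizing x with
  | zero => simp
  | succ n ih =>
    rw [Function.iterate_succ_apply, ih, shiftMap]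
    push_cast
    congr 1
    ring

theorem window_iterate_shiftMap (x : ℤ → A) (n : ℕ) (i : ℤ) (m : ℕ) :
    window (shiftMap^[n] x) i m = window x (i + n) m := by
  rw [window_eq_iff]
  intro k _
  rw [iterate_shiftMap_apply, add_right_comm]

theorem getLastD_window (x : ℤ → A) (i : ℤ) (n : ℕ) :
    (window x (i + 1) n).getLastD (x i) = x (i + n) := by
  induction n generalizing i with
  | zero => simp [window]
  | succ n ih =>
    rw [window, List.getLastD_cons, ih]
    push_cast
    ring_nf

theorem isOpen_setOf_apply_eq [TopologicalSpace A] [DiscreteTopology A] (i : ℤ) (a : A) :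
    IsOpen {x : ℤ → A | x i = a} :=
  (isOpen_discrete ({a} : Set A)).preimage (continuous_apply (A := fun _ => A) i)

theorem isOpen_setOf_window_mem [TopologicalSpace A] [DiscreteTopology A] (T : Set (List A))
    (i : ℤ) (n : ℕ) : IsOpen {x : ℤ → A | window x i n ∈ T} := by
  induction n generalizing T i with
  | zero => simp [window]
  | succ n ih =>
    have : {x : ℤ → A | window x i (n + 1) ∈ T} =
        ⋃ a : A, {x | x i = a} ∩ {x | window x (i + 1) n ∈ List.cons a ⁻¹' T} := by
      ext x
      simp [window]
    rw [this]
    exact isOpen_iUnion fun a => (isOpen_setOf_apply_eq i a).inter (ih _ _)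

/-- Centred cylinders form a neighbourhood basis. -/
theorem exists_cylinder_subset [TopologicalSpace A] {U : Set (ℤ → A)} (hU : IsOpen U)
    {x : ℤ → A} (hx : x ∈ U) : ∃ k : ℕ, ∀ y : ℤ → A, (∀ i : ℤ, |i| ≤ k → y i = x i) → y ∈ U := by
  obtain ⟨I, u, hu, hIU⟩ := isOpen_pi_iff.1 hU x hx
  refine ⟨I.sup Int.natAbs, fun y hy => hIU fun i hi => ?_⟩
  rw [hy i]
  · exact (hu i hi).2
  · rw [Int.abs_eq_natAbs]
    exact_mod_cast Finset.le_sup (f := Int.natAbs) hi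

theorem isOpen_cylinder [TopologicalSpace A] [DiscreteTopology A] (x : ℤ → A) (k : ℕ) :
    IsOpen {y : ℤ → A | ∀ i : ℤ, |i| ≤ k → y i = x i} := by
  have : {y : ℤ → A | ∀ i : ℤ, |i| ≤ k → y i = x i} =
      ⋂ i ∈ Finset.Icc (-(k : ℤ)) k, {y | y i = x i} := by
    ext y
    simp [abs_le]
  rw [this]
  exact isOpen_biInter_finset fun i _ => isOpen_setOf_apply_eq i (x i)

theorem exists_window_eq_of_infix {x : ℤ → A} {i : ℤ} {n : ℕ} {u : List A}
    (hu : u <:+: window x i n) : ∃ j, i ≤ j ∧ window x j u.length = u := by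
  obtain ⟨p, q, h⟩ := hu
  have hlen : n = p.length + u.length + q.length := by
    rw [← length_window x i n, ← h, List.length_append, List.length_append]
  refine ⟨i + p.length, by omega, ?_⟩
  rw [hlen, window_add, window_add] at h
  have h1 := (List.append_inj h (by simp [length_window])).1
  exact (List.append_inj h1 (by simp [length_window])).2.symm

theorem exists_finset_forall_length_mem [Fintype A] (n : ℕ) :
    ∃ D : Finset (List A), D.card ≤ Fintype.card A ^ n ∧ ∀ l : List A, l.length = n → l ∈ D := by
  classical
  induction n with
  | zero => exact ⟨{[]}, by simp, fun l hl => by simpa using hl⟩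
  | succ n ih =>
    obtain ⟨D, hD, hDl⟩ := ih
    refine ⟨Finset.image₂ List.cons Finset.univ D, ?_, fun l hl => ?_⟩
    · rw [pow_succ']
      exact (Finset.card_image₂_le _ _ _).trans (Nat.mul_le_mul_left _ hD)
    · obtain ⟨a, l, rfl⟩ := List.exists_cons_of_length_eq_add_one hl
      exact Finset.mem_image₂_of_mem (Finset.mem_univ a) (hDl l (by simpa using hl))

end Windows

section SFT

variable {A : Type*} {X : Set (ℤ → A)}

/-- The letters occurring in points of `X`. -/
def occurringLetters (X : Set (ℤ → A)) : Set A := {a | ∃ x ∈ X, x 0 = a}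

/-- `b` may follow `a` in a point of `X`. -/
def succRel (X : Set (ℤ → A)) (a b : A) : Prop := ∃ x ∈ X, x 0 = a ∧ x 1 = b

theorem IsOneStepSFT.translate_mem (hX : IsOneStepSFT X) {x : ℤ → A} (hx : x ∈ X) (i : ℤ) :
    (fun j => x (j + i)) ∈ X := by
  obtain ⟨R, rfl⟩ := hX
  intro j
  have := hx (j + i)
  rwa [add_right_comm] at this

theorem IsOneStepSFT.iterate_shiftMap_mem (hX : IsOneStepSFT X) {x : ℤ → A} (hx : x ∈ X) (n : ℕ) :
    shiftMap^[n] x ∈ X := by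
  have : shiftMap^[n] x = fun j => x (j + n) := funext (iterate_shiftMap_apply x n)
  rw [this]
  exact hX.translate_mem hx n

theorem IsOneStepSFT.apply_mem_occurringLetters (hX : IsOneStepSFT X) {x : ℤ → A} (hx : x ∈ X)
    (i : ℤ) : x i ∈ occurringLetters X :=
  ⟨_, hX.translate_mem hx i, by simp⟩

theorem IsOneStepSFT.succRel_apply (hX : IsOneStepSFT X) {x : ℤ → A} (hx : x ∈ X) (i : ℤ) :
    succRel X (x i) (x (i + 1)) :=
  ⟨_, hX.translate_mem hx i, by simp, by simp [add_comm]⟩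

theorem IsOneStepSFT.mem_occurringLetters_of_succRel (hX : IsOneStepSFT X) {a b : A}
    (h : succRel X a b) : b ∈ occurringLetters X := by
  obtain ⟨x, hx, -, rfl⟩ := h
  exact hX.apply_mem_occurringLetters hx 1

theorem IsOneStepSFT.isClosed [TopologicalSpace A] [DiscreteTopology A] (hX : IsOneStepSFT X) :
    IsClosed X := by
  obtain ⟨R, rfl⟩ := hX
  rw [Set.ofPred_forall]
  refine isClosed_iInter fun i => ?_
  exact (isClosed_discrete R).preimage ((continuous_apply i).prodMk (continuous_apply (i + 1)))

/-- Two points agreeing at a position can be glued there. -/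
theorem IsOneStepSFT.glue (hX : IsOneStepSFT X) {x y : ℤ → A} (hx : x ∈ X) (hy : y ∈ X)
    (h : x 0 = y 0) : (fun i => if i ≤ 0 then x i else y i) ∈ X := by
  obtain ⟨R, rfl⟩ := hX
  intro i
  rcases lt_trichotomy i 0 with hi | rfl | hi
  · have h1 : i ≤ 0 := hi.le
    have h2 : i + 1 ≤ 0 := hi
    simpa [h1, h2] using hx i
  · simpa [h] using hy 0
  · have h1 : ¬ i ≤ 0 := by omega
    have h2 : ¬ i + 1 ≤ 0 := by omega
    simpa [h1, h2] using hy i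

variable [Fintype A]

theorem IsOneStepSFT.window_mem_pathsFrom (hX : IsOneStepSFT X) {x : ℤ → A} (hx : x ∈ X)
    (i : ℤ) (n : ℕ) : window x (i + 1) n ∈ pathsFrom (succRel X) n (x i) := by
  induction n generalizing i with
  | zero => simp [window, pathsFrom]
  | succ n ih => exact mem_pathsFrom_succ.2 ⟨_, hX.succRel_apply hx i, _, ih (i + 1), rfl⟩

theorem IsOneStepSFT.exists_window_eq_of_mem_pathsFrom (hX : IsOneStepSFT X) {n : ℕ} {a : A}
    (ha : a ∈ occurringLetters X) {p : List A} (hp : p ∈ pathsFrom (succRel X) n a) :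
    ∃ x ∈ X, window x 0 (n + 1) = a :: p := by
  induction n generalizing a p with
  | zero =>
    obtain rfl : p = [] := by simpa [pathsFrom] using hp
    obtain ⟨x, hx, rfl⟩ := ha
    exact ⟨x, hx, rfl⟩
  | succ n ih =>
    obtain ⟨b, hab, p, hp', rfl⟩ := mem_pathsFrom_succ.1 hp
    obtain ⟨y, hy, hyw⟩ := ih (hX.mem_occurringLetters_of_succRel hab) hp'
    obtain ⟨x, hx, rfl, rfl⟩ := hab
    have hy0 : y 0 = x 1 := (List.cons.inj hyw).1
    have hz := hX.translate_mem (hX.glue (hX.translate_mem hx 1) hy (by simp [hy0])) (-1)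
    refine ⟨_, hz, ?_⟩
    rw [window, ← hyw]
    refine congrArg₂ _ (by simp) ?_
    rw [window_eq_iff]
    intro k _
    rcases k with _ | k
    · simp [hy0]
    · have : ¬ (0 + 1 + ((k + 1 : ℕ) : ℤ) + -1 ≤ 0) := by push_cast; omega
      simp only [this, if_false]
      congr 1
      ring

theorem IsOneStepSFT.card_pathsFrom_le (hX : IsOneStepSFT X) {n N : ℕ} (hnN : n + 1 ≤ N)
    {D : Finset (List A)} (hD : ∀ x ∈ X, window x 0 N ∈ D) {a : A} (ha : a ∈ occurringLetters X) :
    (pathsFrom (succRel X) n a).card ≤ D.card := by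
  classical
  refine le_trans (Finset.card_le_card (t := D.image fun w => (w.take (n + 1)).tail) ?_)
    Finset.card_image_le
  intro p hp
  obtain ⟨x, hx, hxw⟩ := hX.exists_window_eq_of_mem_pathsFrom ha hp
  refine Finset.mem_image.2 ⟨_, hD x hx, ?_⟩
  obtain ⟨r, rfl⟩ := Nat.exists_eq_add_of_le hnN
  rw [window_add, List.take_left' (length_window _ _ _), hxw, List.tail_cons]

theorem IsOneStepSFT.window_mem_blockPaths (hX : IsOneStepSFT X) {good : List A → Prop} (L : ℕ)
    {x : ℤ → A} (hx : x ∈ X) {i : ℤ} (hgood : ∀ j : ℤ, i < j → good (window x j L)) (K : ℕ) :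
    window x (i + 1) (L * K) ∈ blockPaths (succRel X) good L K (x i) := by
  classical
  induction K generalizing i with
  | zero => simp [window, blockPaths]
  | succ K ih =>
    rw [blockPaths, Finset.mem_biUnion]
    refine ⟨window x (i + 1) L, Finset.mem_filter.2 ⟨hX.window_mem_pathsFrom hx i L,
      hgood _ (lt_add_one i)⟩, Finset.mem_image.2 ⟨window x (i + L + 1) (L * K), ?_, ?_⟩⟩
    · rw [getLastD_window]
      exact ih fun j hj => hgood j (by omega)
    · rw [mul_add, mul_one, add_comm (L * K) L, window_add, add_right_comm]

variable [TopologicalSpace A] [DiscreteTopology A]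

theorem TransitiveOn.exists_path (hX : IsOneStepSFT X) (hirr : TransitiveOn X) {a b : A}
    (ha : a ∈ occurringLetters X) (hb : b ∈ occurringLetters X) :
    ∃ n, ∃ p ∈ pathsFrom (succRel X) n a, p.getLastD a = b := by
  obtain ⟨x, hx, hxa⟩ := ha
  obtain ⟨y, hy, hyb⟩ := hb
  obtain ⟨n, -, z, hz, hza, hzb⟩ := hirr _ _ (isOpen_setOf_apply_eq 0 a) (isOpen_setOf_apply_eq 0 b)
     ⟨x, hxa, hx⟩ ⟨y, hyb, hy⟩
  rw [Set.mem_ofPred_eq] at hza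
  rw [Set.mem_ofPred_eq, iterate_shiftMap_apply] at hzb
  subst hza
  exact ⟨n, window z (0 + 1) n, hX.window_mem_pathsFrom hz 0 n, by rw [getLastD_window, hzb]⟩

/-- All letters admit loops of a common positive length running through a given word. -/
theorem TransitiveOn.exists_loops (hX : IsOneStepSFT X) (hirr : TransitiveOn X) {x : ℤ → A}
    (hx : x ∈ X) (i : ℤ) (n : ℕ) :
    ∃ L, 0 < L ∧ ∀ a ∈ occurringLetters X, ∃ c ∈ pathsFrom (succRel X) L a,
      c.getLastD a = a ∧ window x i n <:+: c := by
  have h : ∀ a : A, ∃ l, 0 < l ∧ (a ∈ occurringLetters X → ∃ c ∈ pathsFrom (succRel X) l a,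
      c.getLastD a = a ∧ window x i n <:+: c) := by
    intro a
    by_cases ha : a ∈ occurringLetters X
    · obtain ⟨m₁, p, hp, hpl⟩ := hirr.exists_path hX ha (hX.apply_mem_occurringLetters hx (i - 1))
      obtain ⟨m₂, q, hq, hql⟩ := hirr.exists_path hX
        (hX.apply_mem_occurringLetters hx (i - 1 + (n + 1 : ℕ))) ha
      have hw := hX.window_mem_pathsFrom hx (i - 1) (n + 1)
      have hwl := getLastD_window x (i - 1) (n + 1)
      refine ⟨m₁ + (n + 1) + m₂, by omega, fun _ =>
        ⟨p ++ window x (i - 1 + 1) (n + 1) ++ q, ?_, ?_, ?_⟩⟩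
      · refine append_mem_pathsFrom (append_mem_pathsFrom hp (by rwa [hpl])) ?_
        rwa [getLastD_append_eq, hpl, hwl]
      · rw [getLastD_append_eq, getLastD_append_eq, hpl, hwl, hql]
      · rw [sub_add_cancel, window_add]
        exact ⟨p, window x (i + n) 1 ++ q, by simp⟩
    · exact ⟨1, one_pos, fun h => absurd h ha⟩
  choose l hl hloop using h
  refine ⟨∏ a, l a, Finset.prod_pos fun a _ => hl a, fun a ha => ?_⟩
  obtain ⟨c, hc, hca, hcu⟩ := hloop a ha
  obtain ⟨k, hk⟩ := Finset.dvd_prod_of_mem l (Finset.mem_univ a)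
  have hpos : 0 < ∏ a, l a := Finset.prod_pos fun a _ => hl a
  rcases k with _ | k
  · omega
  · rw [hk]
    exact exists_loop_mul hc hca hcu k

end SFT

section Separated

variable {Ω : Type*} [PseudoMetricSpace Ω] {f : Ω → Ω} {n : ℕ} {ε : ℝ} {B : ℕ}

theorem sepNum_le (hB : ∀ E : Finset Ω, IsSeparatedSet f n ε ↑E → E.card ≤ B) :
    sepNum f n ε ≤ B :=
  csSup_le' fun _ ⟨E, hE, hk⟩ => hk ▸ hB E hE

theorem card_le_sepNum (hB : ∀ E : Finset Ω, IsSeparatedSet f n ε ↑E → E.card ≤ B)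
    {E : Finset Ω} (hE : IsSeparatedSet f n ε ↑E) : E.card ≤ sepNum f n ε :=
  le_csSup ⟨B, fun _ ⟨F, hF, hk⟩ => hk ▸ hB F hF⟩ ⟨E, hE, rfl⟩

theorem one_le_sepNum [Nonempty Ω]
    (hB : ∀ E : Finset Ω, IsSeparatedSet f n ε ↑E → E.card ≤ B) : 1 ≤ sepNum f n ε := by
  obtain ⟨x⟩ := ‹Nonempty Ω›
  refine card_le_sepNum hB (E := {x}) fun y hy z hz hyz => ?_
  simp only [Finset.coe_singleton, Set.mem_singleton_iff] at hy hz
  exact absurd (hy.trans hz.symm) hyz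

/-- A separated set of maximal cardinality is spanning. -/
theorem exists_spanning (hε : 0 ≤ ε)
    (hB : ∀ E : Finset Ω, IsSeparatedSet f n ε ↑E → E.card ≤ B) :
    ∃ E : Finset Ω, E.card = sepNum f n ε ∧
      ∀ y, ∃ e ∈ E, ∀ i < n, dist (f^[i] y) (f^[i] e) ≤ ε := by
  classical
  obtain ⟨E, hE, hcard⟩ : sepNum f n ε ∈
      {k : ℕ | ∃ E : Finset Ω, IsSeparatedSet f n ε ↑E ∧ E.card = k} :=
    Nat.sSup_mem ⟨0, ∅, by simp [IsSeparatedSet], rfl⟩ ⟨B, fun _ ⟨F, hF, hk⟩ => hk ▸ hB F hF⟩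
  refine ⟨E, hcard, fun y => ?_⟩
  by_contra! hy
  have hyE : y ∉ E := fun h => by
    obtain ⟨i, -, hi⟩ := hy y h
    rw [dist_self] at hi
    exact hi.not_ge hε
  have hsep : IsSeparatedSet f n ε ↑(insert y E) := by
    intro a ha b hb hab
    rcases Finset.mem_insert.1 ha with rfl | ha' <;> rcases Finset.mem_insert.1 hb with rfl | hb'
    · exact absurd rfl hab
    · exact hy b hb'
    · simpa only [dist_comm] using hy a ha'
    · exact hE a ha' b hb' hab
  have := card_le_sepNum hB hsep
  rw [Finset.card_insert_of_notMem hyE] at this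
  omega

theorem topEntropy_nonneg (f : Ω → Ω) : 0 ≤ topEntropy f := by
  refine le_trans ?_ (le_iSup₂_of_le (1 : ℝ) one_pos le_rfl)
  calc (0 : EReal) = Filter.atTop.limsup fun _ : ℕ => (0 : EReal) := by simp
    _ ≤ _ := by
      refine Filter.limsup_le_limsup (Filter.Eventually.of_forall fun n => ?_)
      exact EReal.coe_nonneg.2 (div_nonneg (Real.log_natCast_nonneg _) n.cast_nonneg)

theorem topEntropy_le {g : ℝ} (h : ∀ ε : ℝ, 0 < ε → ∃ C : ℝ, ∀ n,
    1 ≤ sepNum f n ε ∧ (sepNum f n ε : ℝ) ≤ C * Real.exp (g * n)) : topEntropy f ≤ g := by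
  refine iSup₂_le fun ε hε => ?_
  obtain ⟨C, hC⟩ := h ε hε
  have hC0 : 0 < C := by
    have h1 : (1 : ℝ) ≤ sepNum f 0 ε := by exact_mod_cast (hC 0).1
    have h2 := (hC 0).2
    simp only [Nat.cast_zero, mul_zero, Real.exp_zero, mul_one] at h2
    linarith
  have hlim : Filter.Tendsto (fun n : ℕ => ((Real.log C / n + g : ℝ) : EReal)) Filter.atTop
      (nhds (g : EReal)) := by
    rw [EReal.tendsto_coe]
    simpa using (tendsto_const_div_atTop_nhds_zero_nat (Real.log C)).add_const g
  rw [← hlim.limsup_eq]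
  refine Filter.limsup_le_limsup ?_
  filter_upwards [Filter.eventually_gt_atTop 0] with n hn
  have hn' : (0 : ℝ) < n := Nat.cast_pos.2 hn
  refine EReal.coe_le_coe_iff.2 ?_
  have hs : (0 : ℝ) < sepNum f n ε := by exact_mod_cast (hC n).1
  have h1 := Real.log_le_log hs (hC n).2
  rw [Real.log_mul hC0.ne' (Real.exp_pos _).ne', Real.log_exp] at h1
  rw [div_add' _ _ _ hn'.ne']
  gcongr

/-- The numbers of separated points grow at most exponentially, at any rate larger than the
entropy. -/
theorem exists_sepNum_le {t : ℝ} (h : topEntropy f < t) (hε : 0 < ε) :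
    ∃ C : ℝ, ∀ n, (sepNum f n ε : ℝ) ≤ C * Real.exp (t * n) := by
  have hlt := (le_iSup₂_of_le (f := fun (ε : ℝ) (_ : 0 < ε) => Filter.atTop.limsup
    (fun n : ℕ => ((Real.log (sepNum f n ε) / n : ℝ) : EReal))) ε hε le_rfl).trans_lt h
  have hev := (Filter.eventually_lt_of_limsup_lt hlt).and (Filter.eventually_gt_atTop 0)
  obtain ⟨N, hN⟩ := Filter.eventually_atTop.1 hev
  refine ⟨1 + ∑ i ∈ Finset.range N, (sepNum f i ε : ℝ) / Real.exp (t * i), fun n => ?_⟩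
  have hsum : ∀ i ∈ Finset.range N, (0 : ℝ) ≤ (sepNum f i ε : ℝ) / Real.exp (t * i) :=
    fun i _ => by positivity
  rw [← div_le_iff₀ (Real.exp_pos _)]
  by_cases hn : n < N
  · have := Finset.single_le_sum hsum (Finset.mem_range.2 hn)
    linarith
  · obtain ⟨h1, h2⟩ := hN n (not_lt.1 hn)
    have h3 : Real.log (sepNum f n ε) < t * n :=
      (div_lt_iff₀ (Nat.cast_pos.2 h2)).1 (EReal.coe_lt_coe_iff.1 h1)
    have h4 : (sepNum f n ε : ℝ) / Real.exp (t * n) ≤ 1 :=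
      (div_le_one (Real.exp_pos _)).2 ((Real.le_exp_log _).trans (Real.exp_le_exp.2 h3.le))
    have := Finset.sum_nonneg hsum
    linarith

end Separated

section Factor

theorem IsOneStepSFT.iterate_apply_eq {A Ω : Type*} {X : Set (ℤ → A)} {f : Ω → Ω}
    {π : (ℤ → A) → Ω} (hX : IsOneStepSFT X)
    (hπf : ∀ x ∈ X, π (shiftMap x) = f (π x))
    {x : ℤ → A} (hx : x ∈ X) (n : ℕ) : f^[n] (π x) = π (shiftMap^[n] x) := by
  induction n with
  | zero => rfl
  | succ n ih =>
    rw [Function.iterate_succ_apply', Function.iterate_succ_apply', ih,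
      hπf _ (hX.iterate_shiftMap_mem hx n)]

variable {A : Type*} {X : Set (ℤ → A)} {Ω : Type*} [MetricSpace Ω] {f : Ω → Ω} {π : (ℤ → A) → Ω}

theorem exists_dist_le_of_agree
    [Finite A] [TopologicalSpace A] [DiscreteTopology A]
    (hX : IsClosed X) (hπ : ContinuousOn π X) {ε : ℝ} (hε : 0 < ε) :
    ∃ k : ℕ, ∀ x ∈ X, ∀ y ∈ X, (∀ i : ℤ, |i| ≤ k → x i = y i) → dist (π x) (π y) ≤ ε := by
  have hloc : ∀ x ∈ X, ∃ k : ℕ, ∀ y ∈ X, (∀ i : ℤ, |i| ≤ k → y i = x i) →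
      dist (π y) (π x) < ε / 2 := by
    intro x hx
    obtain ⟨U, hU, hxU, hUX⟩ := mem_nhdsWithin.1
      ((hπ x hx).eventually (Metric.ball_mem_nhds (π x) (half_pos hε)))
    obtain ⟨k, hk⟩ := exists_cylinder_subset hU hxU
    exact ⟨k, fun y hy h => hUX ⟨hk y h, hy⟩⟩
  choose! k hk using hloc
  obtain ⟨t, htX, ht⟩ := hX.isCompact.elim_nhds_subcover
    (fun x => {y : ℤ → A | ∀ i : ℤ, |i| ≤ k x → y i = x i})
    fun x _ => (isOpen_cylinder x (k x)).mem_nhds fun i _ => rfl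
  refine ⟨t.sup k, fun x hx y hy hxy => ?_⟩
  obtain ⟨z, hz, hxz⟩ := Set.mem_iUnion₂.1 (ht hx)
  have hyz : ∀ i : ℤ, |i| ≤ k z → y i = z i := fun i hi => by
    rw [← hxz i hi, hxy i (hi.trans (by exact_mod_cast Finset.le_sup hz))]
  have h1 := hk z (htX z hz) x hx hxz
  have h2 := hk z (htX z hz) y hy hyz
  have h3 := dist_triangle_right (π x) (π y) (π z)
  linarith

theorem card_le_of_isSeparatedSet (hX : IsOneStepSFT X)
    (hπf : ∀ x ∈ X, π (shiftMap x) = f (π x)) {ε : ℝ} {k : ℕ}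
    (hk : ∀ x ∈ X, ∀ y ∈ X, (∀ i : ℤ, |i| ≤ k → x i = y i) → dist (π x) (π y) ≤ ε)
    {S : Set (ℤ → A)} (hSX : S ⊆ X) {n N : ℕ} (hN : n + 2 * k ≤ N) {D : Finset (List A)}
    (hD : ∀ x ∈ S, window x (-k) N ∈ D) {E : Finset Ω} (hES : ∀ e ∈ E, ∃ x ∈ S, π x = e)
    (hE : IsSeparatedSet f n ε ↑E) : E.card ≤ D.card := by
  rcases E.eq_empty_or_nonempty with rfl | ⟨e₀, he₀⟩
  · simp
  have : Nonempty (ℤ → A) := (hES e₀ he₀).nonempty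
  choose! s hsS hs using hES
  refine Finset.card_le_card_of_injOn (fun e => window (s e) (-k) N) (fun e he => hD _ (hsS e he))
    fun e he e' he' h => ?_
  by_contra hne
  obtain ⟨i, hi, hdist⟩ := hE e he e' he' hne
  refine hdist.not_ge ?_
  rw [← hs e he, ← hs e' he', hX.iterate_apply_eq hπf (hSX (hsS e he)),
    hX.iterate_apply_eq hπf (hSX (hsS e' he'))]
  refine hk _ (hX.iterate_shiftMap_mem (hSX (hsS e he)) i) _
    (hX.iterate_shiftMap_mem (hSX (hsS e' he')) i) fun j hj => ?_
  rw [iterate_shiftMap_apply, iterate_shiftMap_apply]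
  have hj := abs_le.1 hj
  have hw := window_eq_iff.1 h (j + i + k).toNat (by omega)
  rwa [Int.toNat_of_nonneg (by omega), add_comm (j + (i : ℤ)), neg_add_cancel_left] at hw

theorem exists_card_le_of_isSeparatedSet
    [Fintype A] [TopologicalSpace A] [DiscreteTopology A]
    (hX : IsOneStepSFT X) (hπ : ContinuousOn π X)
    (hπsurj : π '' X = Set.univ) (hπf : ∀ x ∈ X, π (shiftMap x) = f (π x)) {ε : ℝ} (hε : 0 < ε)
    (n : ℕ) : ∃ B, ∀ E : Finset Ω, IsSeparatedSet f n ε ↑E → E.card ≤ B := by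
  obtain ⟨k, hk⟩ := exists_dist_le_of_agree hX.isClosed hπ hε
  obtain ⟨D, -, hD⟩ := exists_finset_forall_length_mem (A := A) (n + 2 * k)
  refine ⟨D.card, fun E => card_le_of_isSeparatedSet hX hπf hk subset_rfl le_rfl
    (fun x _ => hD _ (length_window _ _ _)) fun e _ => ?_⟩
  have : e ∈ π '' X := hπsurj ▸ Set.mem_univ e
  exact this

/-- Near each point, the fibres show only the words shown by the fibre of that point. -/
theorem exists_isOpen_window_mem
    [Fintype A] [TopologicalSpace A] [DiscreteTopology A]
    (hX : IsOneStepSFT X) (hπ : ContinuousOn π X) {M : ℕ}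
    (hbdd : ∀ w : Ω, (X ∩ π ⁻¹' {w}).Finite ∧ (X ∩ π ⁻¹' {w}).ncard ≤ M) (m : ℕ) (w : Ω) :
    ∃ (T : Finset (List A)) (U : Set Ω), T.card ≤ M ∧ IsOpen U ∧ w ∈ U ∧
      ∀ x ∈ X, π x ∈ U → window x 0 m ∈ T := by
  classical
  obtain ⟨hfin, hcard⟩ := hbdd w
  set T : Finset (List A) := hfin.toFinset.image fun x => window x 0 m with hT
  have hclosed : IsClosed (π '' (X ∩ {x | window x 0 m ∈ (T : Set (List A))}ᶜ)) :=
    ((hX.isClosed.inter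
      (isOpen_setOf_window_mem _ 0 m).isClosed_compl).isCompact.image_of_continuousOn
      (hπ.mono Set.inter_subset_left)).isClosed
  refine ⟨T, _, ?_, hclosed.isOpen_compl, ?_, fun x hx hxU => ?_⟩
  · refine Finset.card_image_le.trans ?_
    rwa [← Set.ncard_eq_toFinset_card _ hfin]
  · rintro ⟨x, ⟨hx, hxT⟩, hxw⟩
    exact hxT (Finset.mem_image_of_mem (fun x => window x 0 m) (hfin.mem_toFinset.2 ⟨hx, hxw⟩))
  · by_contra hxT
    exact hxU ⟨x, ⟨hx, hxT⟩, rfl⟩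

theorem exists_finset_window_mem (hX : IsOneStepSFT X) {m M : ℕ} {ι : Type*}
    {V : ι → Set (ℤ → A)} {T : ι → Finset (List A)} (hT : ∀ i, (T i).card ≤ M)
    (hV : ∀ i, ∀ x ∈ X, x ∈ V i → window x 0 m ∈ T i) (c : ℕ → ι) (k : ℕ) :
    ∃ D : Finset (List A), D.card ≤ M ^ k ∧
      ∀ x ∈ X, (∀ j < k, shiftMap^[j * m] x ∈ V (c j)) → window x 0 (k * m) ∈ D := by
  classical
  induction k with
  | zero => exact ⟨{[]}, by simp, fun x _ _ => by simp [window]⟩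
  | succ k ih =>
    obtain ⟨D, hD, hDw⟩ := ih
    refine ⟨Finset.image₂ (· ++ ·) D (T (c k)), ?_, fun x hx h => ?_⟩
    · exact (Finset.card_image₂_le _ _ _).trans (pow_succ M k ▸ Nat.mul_le_mul hD (hT _))
    · have h1 := hDw x hx fun j hj => h j (by omega)
      have h2 := hV _ _ (hX.iterate_shiftMap_mem hx (k * m)) (h k (by omega))
      rw [window_iterate_shiftMap] at h2
      rw [Nat.add_mul, one_mul, window_add]
      exact Finset.mem_image₂_of_mem h1 h2

/-- The words of `X` are counted by the separated points of the factor, up to a factor `M` per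
`m` letters. -/
theorem exists_finset_card_le_sepNum_mul
    [Fintype A] [TopologicalSpace A] [DiscreteTopology A]
    [CompactSpace Ω] (hX : IsOneStepSFT X)
    (hπ : ContinuousOn π X) (hπsurj : π '' X = Set.univ)
    (hπf : ∀ x ∈ X, π (shiftMap x) = f (π x)) {M : ℕ}
    (hbdd : ∀ w : Ω, (X ∩ π ⁻¹' {w}).Finite ∧ (X ∩ π ⁻¹' {w}).ncard ≤ M) {m : ℕ} (hm : 0 < m) :
    ∃ ε : ℝ, 0 < ε ∧ ∀ k, ∃ D : Finset (List A), D.card ≤ sepNum f (k * m) ε * M ^ k ∧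
      ∀ x ∈ X, window x 0 (k * m) ∈ D := by
  classical
  choose T U hT hU hwU hUT using exists_isOpen_window_mem hX hπ hbdd m
  obtain ⟨δ, hδ, hball⟩ := lebesgue_number_lemma_of_metric (isCompact_univ (X := Ω)) hU
    fun w _ => Set.mem_iUnion.2 ⟨w, hwU w⟩
  choose c hc using fun w => hball w (Set.mem_univ w)
  refine ⟨δ / 2, half_pos hδ, fun k => ?_⟩
  obtain ⟨B, hB⟩ := exists_card_le_of_isSeparatedSet hX hπ hπsurj hπf (half_pos hδ) (k * m)
  obtain ⟨E, hE, hspan⟩ := exists_spanning (half_pos hδ).le hB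
  choose D hD hDw using fun e : Ω => exists_finset_window_mem hX (V := fun w => π ⁻¹' U w) hT hUT
    (fun j => c (f^[j * m] e)) k
  refine ⟨E.biUnion D, ?_, fun x hx => ?_⟩
  · rw [← hE]
    exact Finset.card_biUnion_le_card_mul _ _ _ fun e _ => hD e
  · obtain ⟨e, he, hxe⟩ := hspan (π x)
    refine Finset.mem_biUnion.2 ⟨e, he, hDw e x hx fun j hj => hc _ ?_⟩
    rw [← hX.iterate_apply_eq hπf hx, Metric.mem_ball]
    exact (hxe _ (Nat.mul_lt_mul_of_pos_right hj hm)).trans_lt (half_lt_self hδ)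

/-- The words of `X` grow at most exponentially, at any rate larger than the entropy of a
bounded-to-one factor. -/
theorem exists_card_pathsFrom_le
    [Fintype A] [TopologicalSpace A] [DiscreteTopology A]
    [CompactSpace Ω] (hX : IsOneStepSFT X)
    (hπ : ContinuousOn π X) (hπsurj : π '' X = Set.univ)
    (hπf : ∀ x ∈ X, π (shiftMap x) = f (π x)) {M : ℕ}
    (hbdd : ∀ w : Ω, (X ∩ π ⁻¹' {w}).Finite ∧ (X ∩ π ⁻¹' {w}).ncard ≤ M) {τ : ℝ}
    (hτ : topEntropy f < τ) :
    ∃ C : ℝ, ∀ a ∈ occurringLetters X, ∀ n,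
      ((pathsFrom (succRel X) n a).card : ℝ) ≤ C * Real.exp τ ^ n := by
  obtain ⟨t, ht, htτ⟩ := EReal.lt_iff_exists_real_btwn.1 hτ
  rw [EReal.coe_lt_coe_iff] at htτ
  have ht0 : 0 ≤ t := by exact_mod_cast (topEntropy_nonneg f).trans ht.le
  obtain ⟨m, hmM, hm⟩ := (((tendsto_const_div_atTop_nhds_zero_nat (Real.log (M + 1))).eventually
    (gt_mem_nhds (sub_pos.2 htτ))).and (Filter.eventually_gt_atTop 0)).exists
  have hm' : (0 : ℝ) < m := Nat.cast_pos.2 hm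
  rw [div_lt_iff₀ hm'] at hmM
  obtain ⟨ε, hε, hD⟩ := exists_finset_card_le_sepNum_mul hX hπ hπsurj hπf hbdd hm
  obtain ⟨C, hC⟩ := exists_sepNum_le ht hε
  have hC0 : 0 ≤ C := by
    have := (Nat.cast_nonneg _).trans (hC 0)
    simpa using this
  refine ⟨C * Real.exp (τ * m), fun a ha n => ?_⟩
  set k := n / m + 1 with hk
  obtain ⟨D, hDcard, hDw⟩ := hD k
  have hnk : n + 1 ≤ k * m := by
    have := Nat.lt_div_mul_add hm (a := n)
    rw [hk, add_mul, one_mul]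
    omega
  have hkn : k * m ≤ n + m := by
    have := Nat.div_mul_le_self n m
    rw [hk, add_mul, one_mul]
    omega
  have hMk : (M : ℝ) ^ k ≤ Real.exp ((τ - t) * (k * m : ℕ)) := by
    calc (M : ℝ) ^ k ≤ ((M : ℝ) + 1) ^ k := by gcongr; linarith
      _ = Real.exp (Real.log (M + 1)) ^ k := by rw [Real.exp_log (by positivity)]
      _ ≤ Real.exp ((τ - t) * m) ^ k := by gcongr
      _ = Real.exp ((τ - t) * (k * m : ℕ)) := by
        rw [← Real.exp_nat_mul]
        push_cast
        ring_nf
  calc ((pathsFrom (succRel X) n a).card : ℝ) ≤ D.card := by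
        exact_mod_cast hX.card_pathsFrom_le hnk hDw ha
    _ ≤ sepNum f (k * m) ε * M ^ k := by exact_mod_cast hDcard
    _ ≤ C * Real.exp (t * (k * m : ℕ)) * Real.exp ((τ - t) * (k * m : ℕ)) :=
        mul_le_mul (hC _) hMk (by positivity) (by positivity)
    _ = C * Real.exp (τ * (k * m : ℕ)) := by
        rw [mul_assoc, ← Real.exp_add]
        ring_nf
    _ ≤ C * Real.exp (τ * (n + m : ℕ)) := by
        have : 0 ≤ τ := ht0.trans htτ.le
        gcongr
    _ = C * Real.exp (τ * m) * Real.exp τ ^ n := by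
        rw [← Real.exp_nat_mul, mul_assoc, ← Real.exp_add]
        push_cast
        ring_nf

theorem topEntropy_lt_top
    [Fintype A] [TopologicalSpace A] [DiscreteTopology A]
    [Nonempty Ω] (hX : IsOneStepSFT X) (hπ : ContinuousOn π X)
    (hπsurj : π '' X = Set.univ) (hπf : ∀ x ∈ X, π (shiftMap x) = f (π x)) :
    topEntropy f < ⊤ := by
  refine (topEntropy_le (g := Real.log (Fintype.card A + 1)) fun ε hε => ?_).trans_lt
    (EReal.coe_lt_top _)
  obtain ⟨k, hk⟩ := exists_dist_le_of_agree hX.isClosed hπ hε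
  refine ⟨((Fintype.card A : ℝ) + 1) ^ (2 * k), fun n => ?_⟩
  obtain ⟨B, hB⟩ := exists_card_le_of_isSeparatedSet hX hπ hπsurj hπf hε n
  refine ⟨one_le_sepNum hB, ?_⟩
  obtain ⟨D, hDcard, hD⟩ := exists_finset_forall_length_mem (A := A) (n + 2 * k)
  have h : sepNum f n ε ≤ D.card := sepNum_le fun E =>
    card_le_of_isSeparatedSet hX hπf hk subset_rfl le_rfl
      (fun x _ => hD _ (length_window _ _ _)) fun e _ => by
        have : e ∈ π '' X := hπsurj ▸ Set.mem_univ e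
        exact this
  calc (sepNum f n ε : ℝ) ≤ (Fintype.card A : ℝ) ^ (n + 2 * k) := by
        exact_mod_cast h.trans hDcard
    _ ≤ ((Fintype.card A : ℝ) + 1) ^ (n + 2 * k) := by gcongr; linarith
    _ = ((Fintype.card A : ℝ) + 1) ^ (2 * k) * Real.exp (Real.log (Fintype.card A + 1) * n) := by
      rw [mul_comm (Real.log _), Real.exp_nat_mul, Real.exp_log (by positivity), pow_add, mul_comm]

/-- Points lying over a proper closed invariant set omit some word of `X`. -/
theorem exists_forbidden_window [TopologicalSpace A] (hX : IsOneStepSFT X) (hπ : ContinuousOn π X)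
    (hπsurj : π '' X = Set.univ) (hπf : ∀ x ∈ X, π (shiftMap x) = f (π x)) {Z : Set Ω}
    (hZclosed : IsClosed Z) (hZinv : Set.MapsTo f Z Z) (hZproper : Z ≠ Set.univ) :
    ∃ x ∈ X, ∃ (i : ℤ) (n : ℕ), ∀ y ∈ X, π y ∈ Z → ∀ (j : ℤ) (L : ℕ), 0 < j →
      ¬ window x i n <:+: window y j L := by
  obtain ⟨w, hw⟩ := (Set.ne_univ_iff_exists_notMem Z).1 hZproper
  obtain ⟨x, hx, rfl⟩ : w ∈ π '' X := hπsurj ▸ Set.mem_univ w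
  obtain ⟨U, hU, hxU, hUX⟩ := mem_nhdsWithin.1
    ((hπ x hx).eventually (hZclosed.isOpen_compl.mem_nhds hw))
  obtain ⟨k, hk⟩ := exists_cylinder_subset hU hxU
  refine ⟨x, hx, -k, 2 * k + 1, fun y hy hyZ j L hj hinf => ?_⟩
  obtain ⟨l, hl, hlw⟩ := exists_window_eq_of_infix hinf
  rw [length_window, window_eq_iff] at hlw
  obtain ⟨n, hn⟩ := Int.eq_ofNat_of_zero_le (show 0 ≤ l + k by omega)
  have hzU : shiftMap^[n] y ∈ U := by
    refine hk _ fun i hi => ?_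
    rw [iterate_shiftMap_apply, ← hn]
    have hi := abs_le.1 hi
    have := hlw (i + k).toNat (by omega)
    rw [Int.toNat_of_nonneg (by omega), add_comm i, neg_add_cancel_left] at this
    rwa [add_comm, add_assoc]
  refine hUX ⟨hzU, hX.iterate_shiftMap_mem hy n⟩ ?_
  rw [← hX.iterate_apply_eq hπf hy]
  exact hZinv.iterate n hyZ

/-- Bound for the entropy of an invariant subset in terms of the words of the points over it. -/
theorem topEntropy_restrict_le
    [Fintype A] [TopologicalSpace A] [DiscreteTopology A]
    (hX : IsOneStepSFT X) (hπ : ContinuousOn π X)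
    (hπsurj : π '' X = Set.univ) (hπf : ∀ x ∈ X, π (shiftMap x) = f (π x)) {Z : Set Ω}
    (hZinv : Set.MapsTo f Z Z) (hZne : Z.Nonempty) {L : ℕ} (hL : 0 < L) {W : ℕ → Finset (List A)}
    (hW : ∀ x ∈ X, π x ∈ Z → ∀ K, window x 1 (L * K) ∈ W K) {C g : ℝ}
    (hC : ∀ K, ((W K).card : ℝ) ≤ C * Real.exp (g * (L * K : ℕ))) :
    topEntropy (hZinv.restrict f Z Z) ≤ g := by
  classical
  have : Nonempty Z := hZne.to_subtype
  have hC0 : 0 ≤ C := by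
    have := (Nat.cast_nonneg _).trans (hC 0)
    simpa using this
  refine topEntropy_le fun ε hε => ?_
  obtain ⟨k, hk⟩ := exists_dist_le_of_agree hX.isClosed hπ hε
  obtain ⟨D, -, hD⟩ := exists_finset_forall_length_mem (A := A) (k + 1)
  refine ⟨D.card * (C * Real.exp (|g| * (L * (k + 1) : ℕ))), fun n => ?_⟩
  set K := n / L + (k + 1) with hK
  have hmul : L * K = n / L * L + L * (k + 1) := by rw [hK]; ring
  have hnK : n + k ≤ L * K := by
    have h1 := Nat.lt_div_mul_add hL (a := n)
    have h2 := Nat.le_mul_of_pos_left k hL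
    rw [hmul, mul_add, mul_one]
    omega
  have hKn : L * K ≤ n + L * (k + 1) := by
    rw [hmul]
    exact Nat.add_le_add_right (Nat.div_mul_le_self n L) _
  have hB : ∀ E : Finset Z, IsSeparatedSet (hZinv.restrict f Z Z) n ε ↑E →
      E.card ≤ (Finset.image₂ (· ++ ·) D (W K)).card := by
    intro E hE
    rw [← Finset.card_map (Function.Embedding.subtype _)]
    refine card_le_of_isSeparatedSet (f := f) (n := n) (S := X ∩ π ⁻¹' Z)
      (N := (k + 1) + L * K) hX hπf hk
      Set.inter_subset_left (by omega) (fun x hx => ?_) (fun e he => ?_) ?_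
    · rw [window_add]
      refine Finset.mem_image₂_of_mem (hD _ (length_window _ _ _)) ?_
      rw [show -(k : ℤ) + (k + 1 : ℕ) = 1 by push_cast; ring]
      exact hW x hx.1 hx.2 K
    · obtain ⟨z, -, rfl⟩ := Finset.mem_map.1 he
      obtain ⟨x, hx, hxz⟩ : (z : Ω) ∈ π '' X := hπsurj ▸ Set.mem_univ _
      exact ⟨x, ⟨hx, show π x ∈ Z from hxz ▸ z.2⟩, hxz⟩
    · intro a ha b hb hab
      obtain ⟨z, hz, rfl⟩ := Finset.mem_map.1 ha
      obtain ⟨z', hz', rfl⟩ := Finset.mem_map.1 hb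
      obtain ⟨i, hi, h⟩ := hE z hz z' hz' fun h => hab (h ▸ rfl)
      refine ⟨i, hi, ?_⟩
      rw [Set.MapsTo.iterate_restrict] at h
      exact h
  refine ⟨one_le_sepNum hB, ?_⟩
  have hexp : Real.exp (g * (L * K : ℕ)) ≤ Real.exp (|g| * (L * (k + 1) : ℕ)) *
      Real.exp (g * n) := by
    rw [← Real.exp_add, Real.exp_le_exp]
    have h1 : (n : ℝ) ≤ (L * K : ℕ) := by exact_mod_cast (Nat.le_add_right n k).trans hnK
    have h2 : ((L * K : ℕ) : ℝ) - n ≤ (L * (k + 1) : ℕ) := by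
      rw [sub_le_iff_le_add']
      exact_mod_cast hKn
    have h3 : g * ((L * K : ℕ) - n) ≤ |g| * (L * (k + 1) : ℕ) :=
      mul_le_mul (le_abs_self g) h2 (sub_nonneg.2 h1) (abs_nonneg g)
    linarith
  calc (sepNum (hZinv.restrict f Z Z) n ε : ℝ)
      ≤ (D.card : ℝ) * (W K).card := by
        exact_mod_cast (sepNum_le hB).trans (Finset.card_image₂_le _ _ _)
    _ ≤ D.card * (C * (Real.exp (|g| * (L * (k + 1) : ℕ)) * Real.exp (g * n))) := by
        gcongr
        exact (hC K).trans (by gcongr)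
    _ = D.card * (C * Real.exp (|g| * (L * (k + 1) : ℕ))) * Real.exp (g * n) := by ring

end Factor

/-- A bounded-to-one factor of an irreducible one-step SFT is entropy-minimal: every
nonempty closed invariant proper subset has strictly smaller topological entropy. -/
theorem entropy_minimal_of_boundedToOne_factor_of_irreducible_SFT
    {A : Type*} [Fintype A] [TopologicalSpace A] [DiscreteTopology A]
    (X : Set (ℤ → A)) (hSFT : IsOneStepSFT X) (hirr : TransitiveOn X)
    {Ω : Type*} [MetricSpace Ω] [CompactSpace Ω]
    (f : Ω → Ω) (hf : Continuous f)
    (π : (ℤ → A) → Ω) (hπcont : ContinuousOn π X) (hπsurj : π '' X = Set.univ)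
    (hπfactor : ∀ x ∈ X, π (shiftMap x) = f (π x))
    (M : ℕ) (hbdd : ∀ w : Ω, (X ∩ π ⁻¹' {w}).Finite ∧ (X ∩ π ⁻¹' {w}).ncard ≤ M)
    (Z : Set Ω) (hZclosed : IsClosed Z) (hZinv : Set.MapsTo f Z Z)
    (hZne : Z.Nonempty) (hZproper : Z ≠ Set.univ) :
    topEntropy (hZinv.restrict f Z Z) < topEntropy f := by
  classical
  have : Nonempty Ω := hZne.nonempty
  obtain ⟨h, hh⟩ : ∃ h : ℝ, topEntropy f = h :=
    ⟨_, (EReal.coe_toReal (topEntropy_lt_top hSFT hπcont hπsurj hπfactor).ne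
      (EReal.bot_lt_zero.trans_le (topEntropy_nonneg f)).ne').symm⟩
  have h0 : 0 ≤ h := by exact_mod_cast hh ▸ topEntropy_nonneg f
  obtain ⟨x, hx, i, n, hforb⟩ :=
    exists_forbidden_window hSFT hπcont hπsurj hπfactor hZclosed hZinv hZproper
  obtain ⟨L, hL, hloop⟩ := hirr.exists_loops hSFT hx i n
  have hL' : (0 : ℝ) < L := Nat.cast_pos.2 hL
  have hexp1 : 1 ≤ Real.exp (h * L) := Real.one_le_exp (by positivity)
  set τ : ℝ := Real.log (Real.exp (h * L) + 1 / 2) / L with hτ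
  have hhτ : h < τ := by
    rw [hτ, lt_div_iff₀ hL', Real.lt_log_iff_exp_lt (by positivity)]
    linarith
  have hτL : Real.exp τ ^ L = Real.exp (h * L) + 1 / 2 := by
    rw [← Real.exp_nat_mul, hτ, mul_div_cancel₀ _ hL'.ne', Real.exp_log (by positivity)]
  set ρ : ℝ := Real.exp τ ^ L - 1 with hρ
  have hρpos : 0 < ρ := by linarith
  obtain ⟨t, hht, htτ⟩ := exists_between hhτ
  obtain ⟨C, hC⟩ := exists_card_pathsFrom_le hSFT hπcont hπsurj hπfactor hbdd
    (τ := t) (by rw [hh]; exact_mod_cast hht)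
  have hocc : ∀ a ∈ occurringLetters X, ∀ b, succRel X a b → b ∈ occurringLetters X :=
    fun a _ b hab => hSFT.mem_occurringLetters_of_succRel hab
  obtain ⟨φ, hφ, hφ1⟩ := exists_superharmonic hocc (Real.exp_pos t) (Real.exp_lt_exp.2 htτ) hC
  set good : List A → Prop := fun p => ¬ window x i n <:+: p with hgood
  have hcard : ∀ K, ∀ a ∈ occurringLetters X,
      ((blockPaths (succRel X) good L K a).card : ℝ) ≤ ρ ^ K * φ a := fun K a ha =>
    card_blockPaths_le hocc (Real.exp_pos τ) hφ hφ1 (fun a ha => by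
      obtain ⟨c, hc, hca, hcu⟩ := hloop a ha
      exact ⟨c, hc, not_not.2 hcu, hca⟩) K ha
  refine (topEntropy_restrict_le hSFT hπcont hπsurj hπfactor hZinv hZne hL
    (W := fun K => (Finset.univ.filter (· ∈ occurringLetters X)).biUnion
      (blockPaths (succRel X) good L K))
    (C := ∑ a ∈ Finset.univ.filter (· ∈ occurringLetters X), φ a) (g := Real.log ρ / L)
    (fun y hy hyZ K => ?_) fun K => ?_).trans_lt ?_
  · refine Finset.mem_biUnion.2 ⟨y 0, by simpa using hSFT.apply_mem_occurringLetters hy 0, ?_⟩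
    exact hSFT.window_mem_blockPaths L hy (i := 0) (fun j hj => hforb y hy hyZ j L hj) K
  · have hρK : Real.exp (Real.log ρ / L * (L * K : ℕ)) = ρ ^ K := by
      rw [Nat.cast_mul, ← mul_assoc, div_mul_cancel₀ _ hL'.ne', mul_comm, Real.exp_nat_mul,
        Real.exp_log hρpos]
    rw [hρK, Finset.sum_mul]
    refine le_trans (Nat.cast_le.2 Finset.card_biUnion_le) ?_
    rw [Nat.cast_sum]
    exact Finset.sum_le_sum fun a ha => (hcard K a (Finset.mem_filter.1 ha).2).trans_eq
      (mul_comm _ _)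
  · rw [hh, EReal.coe_lt_coe_iff, div_lt_iff₀ hL', Real.log_lt_iff_lt_exp hρpos]
    linarith
end

section
/- Let f be an expansive homeomorphism of a compact metric space (X, d). Then for every n ≥ 1 the set P_n(f) = {x ∈ X : f^n(x) = x} is finite, and the topological entropy satisfies h(f) ≥ limsup_{n→∞} (1/n) log p_n(f), where p_n(f) = |P_n(f)|. -/
/-- An expansive homeomorphism: some `ε > 0` separates every pair of distinct points
under some (possibly negative) iterate. -/
def ExpansiveHomeo {Ω : Type*} [MetricSpace Ω] (f : Ω ≃ₜ Ω) : Prop :=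
  ∃ ε : ℝ, 0 < ε ∧ ∀ x y : Ω, x ≠ y →
    ∃ n : ℤ, ε < dist ((f.toEquiv ^ n) x) ((f.toEquiv ^ n) y)

open Filter Topology

/-- By compactness, `(n, ε)`-separated sets are finite, of uniformly bounded cardinality. -/
theorem exists_ncard_le_of_isSeparatedSet {Ω : Type*} [PseudoMetricSpace Ω] [CompactSpace Ω]
    {f : Ω → Ω} (hf : Continuous f) (n : ℕ) {ε : ℝ} (hε : 0 < ε) :
    ∃ N : ℕ, ∀ E : Set Ω, IsSeparatedSet f n ε E → E.Finite ∧ E.ncard ≤ N := by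
  let U : Ω → Set Ω := fun x => {y | ∀ i ∈ Finset.range n, dist (f^[i] y) (f^[i] x) < ε / 2}
  have hU : ∀ x ∈ Set.univ, U x ∈ 𝓝 x := fun x _ => by
    refine (Finset.eventually_all (Finset.range n)).2 fun i _ => ?_
    exact (hf.iterate i).continuousAt.eventually (Metric.ball_mem_nhds _ (half_pos hε))
  obtain ⟨t, -, ht⟩ := isCompact_univ.elim_nhds_subcover U hU
  have hcover : ∀ y, ∃ x ∈ t, y ∈ U x := fun y => by simpa using ht (Set.mem_univ y)
  choose c hct hc using hcover
  refine ⟨t.card, fun E hE => ?_⟩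
  have hinj : Set.InjOn c E := by
    intro x hx y hy hxy
    by_contra hne
    obtain ⟨i, hi, hlt⟩ := hE x hx y hy hne
    have hxi := hc x i (Finset.mem_range.2 hi)
    have hyi := hc y i (Finset.mem_range.2 hi)
    rw [← hxy] at hyi
    linarith [dist_triangle_right (f^[i] x) (f^[i] y) (f^[i] (c x))]
  refine ⟨Set.Finite.of_injOn (fun x _ => hct x) hinj t.finite_toSet, ?_⟩
  rw [← Set.ncard_coe_finset t]
  exact Set.ncard_le_ncard_of_injOn c (fun x _ => hct x) hinj t.finite_toSet

theorem IsSeparatedSet.finite {Ω : Type*} [PseudoMetricSpace Ω] [CompactSpace Ω]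
    {f : Ω → Ω} (hf : Continuous f) {n : ℕ} {ε : ℝ} (hε : 0 < ε) {E : Set Ω}
    (hE : IsSeparatedSet f n ε E) : E.Finite :=
  let ⟨_, hN⟩ := exists_ncard_le_of_isSeparatedSet hf n hε
  (hN E hE).1

theorem IsSeparatedSet.ncard_le_sepNum {Ω : Type*} [PseudoMetricSpace Ω] [CompactSpace Ω]
    {f : Ω → Ω} (hf : Continuous f) {n : ℕ} {ε : ℝ} (hε : 0 < ε) {E : Set Ω}
    (hE : IsSeparatedSet f n ε E) : E.ncard ≤ sepNum f n ε := by
  obtain ⟨N, hN⟩ := exists_ncard_le_of_isSeparatedSet hf n hε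
  have hfin := hE.finite hf hε
  refine le_csSup ⟨N, ?_⟩
    ⟨hfin.toFinset, by simpa using hE, (Set.ncard_eq_toFinset_card E hfin).symm⟩
  rintro _ ⟨F, hF, rfl⟩
  simpa using (hN F hF).2

/-- If `ε` is an expansivity constant, the `n`-periodic points are `(n, ε)`-separated. -/
theorem isSeparatedSet_periodicPts {Ω : Type*} [PseudoMetricSpace Ω] (f : Equiv.Perm Ω) {ε : ℝ}
    (hε : ∀ x y : Ω, x ≠ y → ∃ k : ℤ, ε < dist ((f ^ k) x) ((f ^ k) y)) {n : ℕ} (hn : 0 < n) :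
    IsSeparatedSet f n ε {x | f^[n] x = x} := by
  intro x hx y hy hne
  obtain ⟨k, hk⟩ := hε x y hne
  have hmod : ∀ z, f^[n] z = z → (f ^ k) z = f^[(k % n).toNat] z := fun z hz => by
    have hfix : (f ^ (n : ℤ)) z = z := by simpa [Equiv.Perm.iterate_eq_pow] using hz
    have hk0 : ((k % n).toNat : ℤ) = k % n := Int.toNat_of_nonneg (Int.emod_nonneg _ (by omega))
    calc (f ^ k) z = (f ^ (k % n + n * (k / n))) z := by rw [Int.emod_add_mul_ediv]
      _ = (f ^ (k % n)) z := by
        rw [zpow_add, zpow_mul, Equiv.Perm.mul_apply,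
          Equiv.Perm.zpow_apply_eq_self_of_apply_eq_self hfix]
      _ = f^[(k % n).toNat] z := by rw [Equiv.Perm.iterate_eq_pow, ← zpow_natCast, hk0]
  have hlt := Int.emod_lt_of_pos k (Int.natCast_pos.2 hn)
  exact ⟨(k % n).toNat, by omega, by rwa [← hmod x hx, ← hmod y hy]⟩

/-- For an expansive homeomorphism of a compact metric space, every set of `n`-periodic
points is finite, and the topological entropy is at least the exponential growth rate
of the number of periodic points. -/
theorem entropy_ge_growth_of_periodic_points {Ω : Type*} [MetricSpace Ω] [CompactSpace Ω]
    (f : Ω ≃ₜ Ω) (hexp : ExpansiveHomeo f) :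
    (∀ n : ℕ, 0 < n → {x : Ω | (⇑f)^[n] x = x}.Finite) ∧
    Filter.atTop.limsup
        (fun n : ℕ =>
          ((Real.log (Nat.card {x : Ω | (⇑f)^[n] x = x}) / n : ℝ) : EReal)) ≤
      topEntropy (⇑f) := by
  obtain ⟨ε, hε, hexp⟩ := hexp
  have hsep (n : ℕ) (hn : 0 < n) : IsSeparatedSet f n ε {x : Ω | (⇑f)^[n] x = x} :=
    isSeparatedSet_periodicPts f.toEquiv hexp hn
  refine ⟨fun n hn => (hsep n hn).finite f.continuous hε, ?_⟩
  refine le_trans (limsup_le_limsup ?_) (le_iSup₂ (f := fun (ε : ℝ) (_ : 0 < ε) =>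
    atTop.limsup fun n : ℕ => ((Real.log (sepNum f n ε) / n : ℝ) : EReal)) ε hε)
  filter_upwards [eventually_gt_atTop 0] with n hn
  have hle : Nat.card {x : Ω | (⇑f)^[n] x = x} ≤ sepNum f n ε :=
    (hsep n hn).ncard_le_sepNum f.continuous hε
  refine EReal.coe_le_coe_iff.2 (div_le_div_of_nonneg_right ?_ n.cast_nonneg)
  obtain h0 | hpos := (Nat.card {x : Ω | (⇑f)^[n] x = x}).eq_zero_or_pos
  · rw [h0, Nat.cast_zero, Real.log_zero]
    exact Real.log_natCast_nonneg _
  · exact Real.log_le_log (Nat.cast_pos.2 hpos) (Nat.cast_le.2 hle)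
end

section
/- Let (Ω, f) be a finitely presented (FP) system with Ω nonempty. Then there exist a finite set F ⊆ ℕ, an integer n ≥ 0, positive integers d_1, ..., d_n, and cofinite sets S_1, ..., S_n ⊆ ℕ such that LPS(f) = F ∪ ⋃_{i=1}^n d_i S_i; moreover LPS(f) ≠ ∅, i.e., F and the union ⋃_{i=1}^n d_i S_i may not both be empty. -/
/-- A finitely presented (FP) system: an expansive homeomorphism of a compact metric
space which is a factor of some one-step SFT over some finite alphabet. -/
def IsFPSystem {Ω : Type*} [MetricSpace Ω] [CompactSpace Ω] (f : Ω ≃ₜ Ω) : Prop :=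
  ExpansiveHomeo f ∧
    ∃ (m : ℕ) (X : Set (ℤ → Fin m)) (π : (ℤ → Fin m) → Ω),
      IsOneStepSFT X ∧ ContinuousOn π X ∧ π '' X = Set.univ ∧
        ∀ x ∈ X, π (shiftMap x) = f (π x)

/-- The least period set of a map `f`: those `n ≥ 1` for which there exists a point of
least period exactly `n`. -/
def leastPeriodSet {Ω : Type*} (f : Ω → Ω) : Set ℕ :=
  {n | 0 < n ∧ ∃ x, f^[n] x = x ∧ ∀ k, 0 < k → k < n → f^[k] x ≠ x}

/-- `S` is a cofinite subset of `ℕ = {1, 2, 3, ...}`. -/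
def CofinitePos (S : Set ℕ) : Prop :=
  S ⊆ {n : ℕ | 0 < n} ∧ ({n : ℕ | 0 < n} \ S).Finite

open Function

section Coding

variable {Ω A : Type*}

/-- The bi-infinite sequences all of whose consecutive pairs are related by `R`. -/
def biPaths (R : A → A → Prop) : Set (ℤ → A) :=
  {x | ∀ i, R (x i) (x (i + 1))}

lemma biPaths_shift {R : A → A → Prop} {x : ℤ → A} (hx : x ∈ biPaths R) (k : ℤ) :
    (fun i => x (i + k)) ∈ biPaths R := fun i => by
  simpa only [add_right_comm] using hx (i + k)

/-- `π` codes the dynamics of `g` by the one-step shift of finite type with transition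
relation `R`, and two sequences code the same point iff they are coordinatewise
`W`-related. -/
structure IsCoding (g : Equiv.Perm Ω) (R W : A → A → Prop) (π : (ℤ → A) → Ω) : Prop where
  map_shift : ∀ x ∈ biPaths R, ∀ k : ℤ, π (fun i => x (i + k)) = (g ^ k) (π x)
  map_eq_iff : ∀ x ∈ biPaths R, ∀ y ∈ biPaths R, π x = π y ↔ ∀ i, W (x i) (y i)
  surj : ∀ ω, ∃ x ∈ biPaths R, π x = ω

lemma map_shift_zpow {g : Equiv.Perm Ω} {R : A → A → Prop} {π : (ℤ → A) → Ω}
    (h : ∀ x ∈ biPaths R, π (fun i => x (i + 1)) = g (π x)) :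
    ∀ x ∈ biPaths R, ∀ k : ℤ, π (fun i => x (i + k)) = (g ^ k) (π x) := by
  intro x hx k
  induction k with
  | zero => simp
  | succ k ih =>
    have := h _ (biPaths_shift hx k)
    rw [ih] at this
    rw [add_comm (k : ℤ) 1, zpow_add, zpow_one, Equiv.Perm.mul_apply, ← this]
    simp only [add_assoc]
  | pred k ih =>
    have := h _ (biPaths_shift hx (-k - 1))
    simp only [show ∀ i : ℤ, i + 1 + (-k - 1) = i + -k by intro i; ring] at this
    apply g.injective
    rw [← this, ih, ← Equiv.Perm.mul_apply, ← zpow_one_add]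
    congr 2
    ring

/-- Every one of a family of sets with successors and predecessors is traversed by a
bi-infinite path. -/
lemma exists_biPath_through {R : A → A → Prop} (K : ℤ → Set A)
    (hs : ∀ i, ∀ a ∈ K i, ∃ b ∈ K (i + 1), R a b)
    (hp : ∀ i, ∀ b ∈ K (i + 1), ∃ a ∈ K i, R a b) (i₀ : ℤ) {a : A} (ha : a ∈ K i₀) :
    ∃ x ∈ biPaths R, (∀ i, x i ∈ K i) ∧ x i₀ = a := by
  wlog h0 : i₀ = 0 generalizing K i₀
  · obtain ⟨x, hx, hxK, hx0⟩ := this (fun i => K (i + i₀))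
      (fun i b hb => by simpa only [add_right_comm] using hs (i + i₀) b hb)
      (fun i b hb => hp (i + i₀) b (by simpa only [add_right_comm] using hb))
      0 (by simpa using ha) rfl
    refine ⟨_, biPaths_shift hx (-i₀), fun i => by simpa using hxK (i + -i₀), by simpa using hx0⟩
  subst h0
  choose! s hsK hsR using hs
  choose! p hpK hpR using hp
  let u : ℕ → A := fun n => n.rec a fun k b => s k b
  let w : ℕ → A := fun n => n.rec a fun k b => p (-(k : ℤ) - 1) b
  have hu : ∀ n : ℕ, u n ∈ K n := by
    intro n
    induction n with
    | zero => exact ha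
    | succ n ih => exact_mod_cast hsK n _ ih
  have hw : ∀ n : ℕ, w n ∈ K (-n) := by
    intro n
    induction n with
    | zero => exact ha
    | succ n ih =>
      have := hpK (-(n : ℤ) - 1) (w n) (by simpa using ih)
      convert this using 2
      push_cast; ring
  let x : ℤ → A := fun i => if 0 ≤ i then u i.toNat else w (-i).toNat
  have hxu : ∀ n : ℕ, x n = u n := fun n => by simp [x]
  have hxw : ∀ n : ℕ, x (-n) = w n := fun n => by
    rcases n with _ | n
    · simp [x, u, w]
    · have : ¬ (0 ≤ -((n + 1 : ℕ) : ℤ)) := by omega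
      simp only [x, if_neg this, neg_neg, Int.toNat_natCast]
  refine ⟨x, fun i => ?_, fun i => ?_, by simp [x, u]⟩
  · rcases le_or_gt 0 i with hi | hi
    · lift i to ℕ using hi
      have := hxu (i + 1)
      push_cast at this
      rw [hxu, this]
      exact hsR i _ (hu i)
    · obtain ⟨n, rfl⟩ : ∃ n : ℕ, i = -((n + 1 : ℕ) : ℤ) := ⟨(-i - 1).toNat, by omega⟩
      have e : -((n + 1 : ℕ) : ℤ) + 1 = -(n : ℤ) := by push_cast; ring
      have e' : -(n : ℤ) - 1 = -((n + 1 : ℕ) : ℤ) := by push_cast; ring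
      rw [hxw, e, hxw]
      exact hpR (-(n : ℤ) - 1) (w n) (by simpa using hw n)
  · rcases le_or_gt 0 i with hi | hi
    · lift i to ℕ using hi
      rw [hxu]; exact hu i
    · obtain ⟨n, rfl⟩ : ∃ n : ℕ, i = -(n : ℤ) := ⟨(-i).toNat, by omega⟩
      rw [hxw]; exact hw n

/-- Transitions between nonempty sets of pairwise `W`-related symbols. -/
def CliqueStep (R W : A → A → Prop) (K L : Set A) : Prop :=
  K.Nonempty ∧ (∀ a ∈ K, ∀ b ∈ K, W a b) ∧ (∀ a ∈ K, ∃ b ∈ L, R a b) ∧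
    ∀ b ∈ L, ∃ a ∈ K, R a b

/-- Passing to cliques of symbols, a coding becomes one in which periodic points have
codes of the same period. -/
lemma IsCoding.exists_clique_coding [Nonempty Ω] {g : Equiv.Perm Ω} {R W : A → A → Prop}
    {π : (ℤ → A) → Ω} (h : IsCoding g R W π) :
    ∃ (W' : Set A → Set A → Prop) (π' : (ℤ → Set A) → Ω),
      IsCoding g (CliqueStep R W) W' π' ∧
      ∀ (n : ℕ) (ω : Ω), g^[n] ω = ω →
        ∃ K ∈ biPaths (CliqueStep R W), π' K = ω ∧ ∀ i, K (i + n) = K i := by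
  have ex : ∀ K ∈ biPaths (CliqueStep R W), ∀ i, ∀ a ∈ K i,
      ∃ x ∈ biPaths R, (∀ i, x i ∈ K i) ∧ x i = a := fun K hK i a ha =>
    exists_biPath_through K (fun i => (hK i).2.2.1) (fun i => (hK i).2.2.2) i ha
  have ex0 : ∀ K ∈ biPaths (CliqueStep R W), ∃ x ∈ biPaths R, ∀ i, x i ∈ K i := by
    intro K hK
    obtain ⟨a, ha⟩ := (hK 0).1
    obtain ⟨x, hx, hxK, -⟩ := ex K hK 0 a ha
    exact ⟨x, hx, hxK⟩
  obtain ⟨x₀, -, -⟩ := h.surj (Classical.arbitrary Ω)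
  have : Nonempty (ℤ → A) := ⟨x₀⟩
  choose! c hc hcK using ex0
  have hπ : ∀ K ∈ biPaths (CliqueStep R W), ∀ x ∈ biPaths R, (∀ i, x i ∈ K i) →
      π (c K) = π x := fun K hK x hx hxK =>
    (h.map_eq_iff _ (hc K hK) _ hx).2 fun i => (hK i).2.1 _ (hcK K hK i) _ (hxK i)
  have surj : ∀ (n : ℕ) (ω : Ω), g^[n] ω = ω →
        ∃ K ∈ biPaths (CliqueStep R W), π (c K) = ω ∧ ∀ i, K (i + n) = K i := by
    intro n ω hω
    obtain ⟨y, hy, rfl⟩ := h.surj ω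
    have hfix : ∀ j : ℤ, π (fun i => y (i + j * n)) = π y := by
      intro j
      rw [h.map_shift y hy, mul_comm, zpow_mul, zpow_natCast]
      rw [Equiv.Perm.iterate_eq_pow] at hω
      exact Equiv.Perm.zpow_apply_eq_self_of_apply_eq_self hω j
    let K : ℤ → Set A := fun i => {a | ∃ j : ℤ, y (i + j * n) = a}
    have hyK : ∀ i, y i ∈ K i := fun i => ⟨0, by simp⟩
    have hK : K ∈ biPaths (CliqueStep R W) := by
      intro i
      refine ⟨⟨y i, hyK i⟩, ?_, ?_, ?_⟩
      · rintro _ ⟨j, rfl⟩ _ ⟨l, rfl⟩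
        exact (h.map_eq_iff _ (biPaths_shift hy _) _ (biPaths_shift hy _)).1
          ((hfix j).trans (hfix l).symm) i
      · rintro _ ⟨j, rfl⟩
        exact ⟨_, ⟨j, rfl⟩, by simpa only [add_right_comm] using hy (i + j * n)⟩
      · rintro _ ⟨j, rfl⟩
        exact ⟨_, ⟨j, rfl⟩, by simpa only [add_right_comm] using hy (i + j * n)⟩
    refine ⟨K, hK, hπ K hK y hy hyK, fun i => ?_⟩
    ext a
    constructor
    · rintro ⟨j, rfl⟩
      exact ⟨j + 1, by congr 1; ring⟩
    · rintro ⟨j, rfl⟩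
      exact ⟨j - 1, by congr 1; ring⟩
  refine ⟨fun K L => ∀ a ∈ K, ∀ b ∈ L, W a b, fun K => π (c K), ⟨?_, ?_, ?_⟩, surj⟩
  · intro K hK k
    rw [← h.map_shift _ (hc K hK)]
    exact hπ _ (biPaths_shift hK k) _ (biPaths_shift (hc K hK) k) fun i => hcK K hK (i + k)
  · intro K hK L hL
    constructor
    · intro e i a ha b hb
      obtain ⟨x, hx, hxK, rfl⟩ := ex K hK i a ha
      obtain ⟨y, hy, hyL, rfl⟩ := ex L hL i b hb
      refine (h.map_eq_iff x hx y hy).1 ?_ i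
      rw [← hπ K hK x hx hxK, ← hπ L hL y hy hyL, e]
    · intro hW
      exact (h.map_eq_iff _ (hc K hK) _ (hc L hL)).2 fun i => hW i _ (hcK K hK i) _ (hcK L hL i)
  · intro ω
    obtain ⟨K, hK, e, -⟩ := surj 0 ω rfl
    exact ⟨K, hK, e⟩

/-- The first `ℓ` steps of `w` follow the transition relation `R`. -/
def IsWalk (R : A → A → Prop) (w : ℕ → A) (ℓ : ℕ) : Prop :=
  ∀ i < ℓ, R (w i) (w (i + 1))

/-- The sequence following `u` for `k` steps and `w` afterwards. -/
def walkAppend (k : ℕ) (u w : ℕ → A) : ℕ → A := fun i => if i < k then u i else w (i - k)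

lemma walkAppend_of_lt {k i : ℕ} (h : i < k) (u w : ℕ → A) : walkAppend k u w i = u i :=
  if_pos h

lemma walkAppend_add (k i : ℕ) (u w : ℕ → A) : walkAppend k u w (k + i) = w i := by
  simp [walkAppend]

lemma walkAppend_zero {k : ℕ} {u w : ℕ → A} (h : u k = w 0) : walkAppend k u w 0 = u 0 := by
  rcases Nat.eq_zero_or_pos k with rfl | hk
  · simpa [walkAppend] using h.symm
  · exact walkAppend_of_lt hk u w

lemma IsWalk.append {R : A → A → Prop} {k ℓ : ℕ} {u w : ℕ → A} (hu : IsWalk R u k)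
    (hw : IsWalk R w ℓ) (h : u k = w 0) : IsWalk R (walkAppend k u w) (k + ℓ) := by
  intro i hi
  rcases lt_trichotomy (i + 1) k with hk | hk | hk
  · rw [walkAppend_of_lt hk, walkAppend_of_lt (by omega)]
    exact hu i (by omega)
  · have : walkAppend k u w (i + 1) = u k := by
      rw [hk, h]; exact walkAppend_add k 0 u w
    rw [this, walkAppend_of_lt (by omega), ← hk]
    exact hu i (by omega)
  · obtain ⟨j, rfl⟩ := Nat.exists_eq_add_of_le (show k ≤ i by omega)
    rw [add_assoc, walkAppend_add, walkAppend_add]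
    exact hw j (by omega)

/-- The lengths of the closed walks at `v`. -/
def loopLengths (R : A → A → Prop) (v : A) : AddSubmonoid ℕ where
  carrier := {ℓ | ∃ w : ℕ → A, w 0 = v ∧ w ℓ = v ∧ IsWalk R w ℓ}
  zero_mem' := ⟨fun _ => v, rfl, rfl, fun _ h => absurd h (Nat.not_lt_zero _)⟩
  add_mem' := by
    rintro k ℓ ⟨u, hu0, huk, hu⟩ ⟨w, hw0, hwl, hw⟩
    have e : u k = w 0 := huk.trans hw0.symm
    exact ⟨walkAppend k u w, (walkAppend_zero e).trans hu0,
      (walkAppend_add k ℓ u w).trans hwl, hu.append hw e⟩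

lemma exists_mem_loopLengths_of_ge (R : A → A → Prop) (v : A) :
    ∃ N, ∀ m ≥ N, Nat.setGcd (loopLengths R v : Set ℕ) ∣ m → m ∈ loopLengths R v := by
  simpa only [AddSubmonoid.closure_eq] using
    Nat.exists_mem_closure_of_ge (loopLengths R v : Set ℕ)

/-- The `ℓ`-periodic bi-infinite sequence repeating the first `ℓ` terms of `w`. -/
def periodize (ℓ : ℕ) (w : ℕ → A) : ℤ → A := fun i => w (i % ℓ).toNat

lemma periodize_add (ℓ : ℕ) (w : ℕ → A) (i : ℤ) : periodize ℓ w (i + ℓ) = periodize ℓ w i := by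
  simp [periodize]

lemma periodize_of_lt {ℓ : ℕ} (w : ℕ → A) {i : ℕ} (h : i < ℓ) : periodize ℓ w i = w i := by
  simp only [periodize]
  rw [Int.emod_eq_of_lt (by omega) (by omega), Int.toNat_natCast]

lemma IsWalk.periodize_mem {R : A → A → Prop} {ℓ : ℕ} {w : ℕ → A} (hw : IsWalk R w ℓ)
    (hℓ : 0 < ℓ) (h : w ℓ = w 0) : periodize ℓ w ∈ biPaths R := by
  intro i
  have h0 := Int.emod_nonneg i (show (ℓ : ℤ) ≠ 0 by omega)
  have h1 := Int.emod_lt_of_pos i (show (0 : ℤ) < ℓ by omega)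
  obtain ⟨r, hr⟩ := Int.eq_ofNat_of_zero_le h0
  have hi := hw r (by omega)
  have e1 : periodize ℓ w i = w r := by simp [periodize, hr]
  have e2 : periodize ℓ w (i + 1) = w (r + 1) := by
    simp only [periodize]
    rw [Int.add_emod, hr]
    rcases (show r + 1 < ℓ ∨ r + 1 = ℓ by omega) with h' | h'
    · congr 1
      rw [Int.add_emod_emod, Int.emod_eq_of_lt (by omega) (by omega)]
      omega
    · rw [Int.add_emod_emod, h', h]
      have : ((r : ℤ) + 1) % ℓ = 0 := by rw [← h']; simp
      rw [this]; rfl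
  rw [e1, e2]
  exact hi

lemma apply_add_mul_of_periodic {x : ℤ → A} {n : ℤ} (h : ∀ i, x (i + n) = x i) (k i : ℤ) :
    x (i + k * n) = x i := by
  have : Function.Periodic x n := h
  exact this.int_mul k i

lemma IsCoding.map_shift_nat {g : Equiv.Perm Ω} {R W : A → A → Prop} {π : (ℤ → A) → Ω}
    (h : IsCoding g R W π) {x : ℤ → A} (hx : x ∈ biPaths R) (k : ℕ) :
    π (fun i => x (i + k)) = g^[k] (π x) := by
  rw [h.map_shift x hx, zpow_natCast, Equiv.Perm.iterate_eq_pow]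

lemma IsCoding.isPeriodicPt {g : Equiv.Perm Ω} {R W : A → A → Prop} {π : (ℤ → A) → Ω}
    (h : IsCoding g R W π) {x : ℤ → A} (hx : x ∈ biPaths R) {n : ℕ}
    (hn : ∀ i, x (i + n) = x i) : IsPeriodicPt g n (π x) := by
  rw [IsPeriodicPt, IsFixedPt, ← h.map_shift_nat hx]
  simp only [hn]

lemma mem_leastPeriodSet_iff {f : Ω → Ω} {n : ℕ} :
    n ∈ leastPeriodSet f ↔ 0 < n ∧ ∃ x, minimalPeriod f x = n := by
  refine and_congr_right fun hn => exists_congr fun x => ⟨?_, ?_⟩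
  · rintro ⟨h, hk⟩
    have hp : IsPeriodicPt f n x := h
    refine le_antisymm (hp.minimalPeriod_le hn) (not_lt.1 fun hlt => ?_)
    exact hk _ (hp.minimalPeriod_pos hn) hlt (iterate_minimalPeriod (f := f) (x := x))
  · rintro rfl
    exact ⟨iterate_minimalPeriod, fun k hk hlt h =>
      (hlt.not_ge) (IsPeriodicPt.minimalPeriod_le hk h)⟩

/-- A point of large least period produces points of almost every least period that is
a multiple of the gcd of the loop lengths at some symbol. -/
lemma IsCoding.exists_loop_gcd [Finite A] {g : Equiv.Perm Ω} {R W : A → A → Prop}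
    {π : (ℤ → A) → Ω} (h : IsCoding g R W π) {x : ℤ → A} (hx : x ∈ biPaths R) {n : ℕ}
    (hn : ∀ i, x (i + n) = x i) (hmin : minimalPeriod g (π x) = n) (hlt : Nat.card A < n) :
    ∃ v : A, Nat.setGcd (loopLengths R v : Set ℕ) ∣ n ∧
      0 < Nat.setGcd (loopLengths R v : Set ℕ) ∧
      ∃ M, ∀ m ≥ M, Nat.setGcd (loopLengths R v : Set ℕ) ∣ m → m ∈ leastPeriodSet g := by
  obtain ⟨a, c, hc0, hcn, hac⟩ : ∃ a c : ℕ, 0 < c ∧ c < n ∧ x a = x (a + c) := by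
    have : ¬ Injective fun i : Fin (Nat.card A + 1) => x (i : ℕ) := fun hinj => by
      have := Nat.card_le_card_of_injective _ hinj
      simp at this
    simp only [Injective, not_forall] at this
    obtain ⟨i, j, hij, hne⟩ := this
    rcases lt_or_gt_of_ne (fun e => hne (Fin.ext e) : (i : ℕ) ≠ j) with hl | hl
    · exact ⟨i, j - i, by omega, by omega, by rw [hij]; congr 1; omega⟩
    · exact ⟨j, i - j, by omega, by omega, by rw [← hij]; congr 1; omega⟩
  have hn0 : 0 < n := hc0.trans hcn
  -- the code `β` of a point of the same orbit, based at a symbol seen again after `c` steps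
  set β : ℤ → A := fun i => x (i + a) with hβdef
  have hβ : β ∈ biPaths R := biPaths_shift hx a
  have hβn : ∀ i, β (i + n) = β i := fun i => by
    simp only [hβdef]; rw [add_right_comm]; exact hn _
  have hβmin : minimalPeriod g (π β) = n := by
    rw [hβdef, h.map_shift_nat hx]
    rw [minimalPeriod_apply_iterate, hmin]
    exact mk_mem_periodicPts hn0 (h.isPeriodicPt hx hn)
  set v := β 0 with hv
  have hβc : β c = v := by
    simp only [hv, hβdef]; rw [zero_add, hac]; congr 1; ring
  have hβw : ∀ k, IsWalk R (fun i : ℕ => β i) k := fun k i _ => by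
    simpa using hβ i
  set L := loopLengths R v with hL
  have hcL : c ∈ L := ⟨fun i : ℕ => β i, rfl, hβc, hβw c⟩
  have hnL : n ∈ L := ⟨fun i : ℕ => β i, rfl, by simpa using hβn 0, hβw n⟩
  set d := Nat.setGcd (L : Set ℕ) with hd
  have hdc : d ∣ c := Nat.setGcd_dvd_of_mem hcL
  have hdn : d ∣ n := Nat.setGcd_dvd_of_mem hnL
  refine ⟨v, hdn, Nat.pos_of_dvd_of_pos hdc hc0, ?_⟩
  obtain ⟨N, hN⟩ := exists_mem_loopLengths_of_ge R v
  set α : ℤ → A := periodize c fun i => β i with hαdef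
  have hα : α ∈ biPaths R := (hβw c).periodize_mem hc0 hβc
  have hαc : ∀ i, α (i + c) = α i := periodize_add _ _
  have hα0 : α 0 = v := by simpa using periodize_of_lt (fun i : ℕ => β i) hc0
  have hαw : ∀ k, IsWalk R (fun i : ℕ => α i) k := fun k i _ => by
    simpa using hα i
  refine ⟨3 * (c * n + (c * N + c)), fun m hm hdm => ?_⟩
  set e := c * N + m % c with he
  have hec : e < c * N + c := by have := Nat.mod_lt m hc0; omega
  have hNc : N ≤ c * N := Nat.le_mul_of_pos_left N hc0
  have hde : d ∣ e := (hdc.mul_right N).add ((Nat.dvd_mod_iff hdc).2 hdm)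
  obtain ⟨ε, hε0, hεe, hε⟩ := hN e (by omega) hde
  obtain ⟨s, hs⟩ : ∃ s, m = c * n + e + c * s := by
    have h1 : c ∣ m - (c * n + e) := by
      have h2 : m - (c * n + e) = c * (m / c) - c * (n + N) := by
        have := Nat.div_add_mod m c
        rw [mul_add]; omega
      rw [h2]
      exact Nat.dvd_sub (dvd_mul_right _ _) (dvd_mul_right _ _)
    obtain ⟨s, hs⟩ := h1
    exact ⟨s, by omega⟩
  have hβcn : β ((c * n : ℕ) : ℤ) = v := by
    have := apply_add_mul_of_periodic hβn c 0
    push_cast; simpa using this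
  have hαcs : α ((c * s : ℕ) : ℤ) = v := by
    have := apply_add_mul_of_periodic hαc s 0
    push_cast; rw [mul_comm]; simpa [hα0] using this
  set w₁ : ℕ → A := walkAppend e ε (fun i => α i) with hw₁
  have hw₁0 : w₁ 0 = v := (walkAppend_zero (hεe.trans hα0.symm)).trans hε0
  have hw₁w : IsWalk R w₁ (e + c * s) := hε.append (hαw _) (hεe.trans hα0.symm)
  set w : ℕ → A := walkAppend (c * n) (fun i => β i) w₁ with hw
  have hww : IsWalk R w m := by
    rw [hs, add_assoc]
    exact (hβw _).append hw₁w (hβcn.trans hw₁0.symm)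
  have hw0 : w 0 = v := walkAppend_zero (hβcn.trans hw₁0.symm)
  have hwα : ∀ i : ℕ, w (c * n + e + i) = α i := fun i => by
    rw [add_assoc, hw, walkAppend_add, hw₁, walkAppend_add]
  have hwm : w m = w 0 := by rw [hw0, hs, hwα, hαcs]
  have hm0 : 0 < m := by omega
  have hy : periodize m w ∈ biPaths R := hww.periodize_mem hm0 hwm
  have hyp := h.isPeriodicPt hy (periodize_add m w)
  set p := π (periodize m w) with hp
  refine mem_leastPeriodSet_iff.2 ⟨hm0, p, ?_⟩
  by_contra hne
  obtain ⟨q, hq⟩ := hyp.minimalPeriod_dvd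
  set r := minimalPeriod g p with hr
  have hr0 : 0 < r := hyp.minimalPeriod_pos hm0
  have hrm : 2 * r ≤ m := by
    rcases q with _ | _ | q
    · omega
    · omega
    · rw [hq]; nlinarith
  obtain ⟨j, hj1, hj2⟩ : ∃ j, c * n + e ≤ r * j ∧ r * j + c * n ≤ m := by
    rcases le_or_gt (c * n + e) r with hle | hle
    · exact ⟨1, by omega, by omega⟩
    · refine ⟨(c * n + e) / r + 1, ?_, ?_⟩ <;>
      · have := Nat.div_add_mod (c * n + e) r
        have := Nat.mod_lt (c * n + e) hr0
        rw [mul_add]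
        omega
  obtain ⟨t, ht⟩ := Nat.exists_eq_add_of_le hj1
  -- the block `β ^ n` of the code of `p` is matched with a block of `α`
  have hfix : π (fun i => periodize m w (i + (r * j : ℕ))) = p := by
    rw [h.map_shift_nat hy]
    exact (isPeriodicPt_minimalPeriod g p).mul_const j
  have hW := (h.map_eq_iff _ hy _ (biPaths_shift hy _)).1 hfix.symm
  have hmatch : ∀ i : ℕ, i < c * n → W (β i) (α (i + t)) := by
    intro i hi
    have h1 := hW i
    rw [← Nat.cast_add, periodize_of_lt w (by omega), periodize_of_lt w (by omega),
      hw, walkAppend_of_lt hi, ← hw, ht, show i + (c * n + e + t) = c * n + e + (i + t) by ring,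
      hwα] at h1
    exact_mod_cast h1
  have hall : ∀ i : ℤ, W (β i) (α (i + t)) := by
    intro i
    have hcn0 : (0 : ℤ) < ((c * n : ℕ) : ℤ) := by exact_mod_cast Nat.mul_pos hc0 hn0
    obtain ⟨k, hk⟩ := Int.eq_ofNat_of_zero_le (Int.emod_nonneg i hcn0.ne')
    have hk' := Int.emod_lt_of_pos i hcn0
    have hdm := Int.emod_add_mul_ediv i ((c * n : ℕ) : ℤ)
    set z := i / ((c * n : ℕ) : ℤ)
    have h1 := hmatch k (by omega)
    have e1 : β i = β k := by
      rw [← apply_add_mul_of_periodic hβn (c * z) k, ← hdm, hk]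
      congr 1; push_cast; ring
    have e2 : α (i + t) = α (k + t) := by
      rw [← apply_add_mul_of_periodic hαc (n * z) (k + t), ← hdm, hk]
      congr 1; push_cast; ring
    rwa [e1, e2]
  have heq : π β = π (fun i => α (i + t)) :=
    (h.map_eq_iff _ hβ _ (biPaths_shift hα t)).2 hall
  have hper : IsPeriodicPt g c (π β) := by
    rw [heq]
    refine h.isPeriodicPt (biPaths_shift hα t) fun i => ?_
    rw [add_right_comm]; exact hαc _
  have := hper.minimalPeriod_le hc0
  omega

lemma IsCoding.leastPeriodSet_nonempty [Finite A] [Nonempty Ω] {g : Equiv.Perm Ω}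
    {R W : A → A → Prop} {π : (ℤ → A) → Ω} (h : IsCoding g R W π) :
    (leastPeriodSet g).Nonempty := by
  obtain ⟨x, hx, -⟩ := h.surj (Classical.arbitrary Ω)
  obtain ⟨i, j, hne, hij⟩ := Finite.exists_ne_map_eq_of_infinite fun i : ℕ => x i
  wlog hlt : i < j generalizing i j
  · exact this j i hne.symm hij.symm (by omega)
  have hw : IsWalk R (fun k : ℕ => x (k + i)) (j - i) := fun k _ => by
    have := hx (k + i)
    rw [add_right_comm] at this
    exact_mod_cast this
  have hy := hw.periodize_mem (by omega) (by
    rw [Nat.cast_sub hlt.le, sub_add_cancel, Nat.cast_zero, zero_add]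
    exact hij.symm)
  have hp := h.isPeriodicPt hy (periodize_add _ _)
  exact ⟨_, mem_leastPeriodSet_iff.2 ⟨hp.minimalPeriod_pos (by omega), _, rfl⟩⟩

end Coding

section Window

open Topology

/-- A continuous function on a compact set of sequences over a discrete alphabet is
uniformly approximated by functions of a finite window. -/
lemma exists_window {Ω A : Type*} [PseudoMetricSpace Ω] [TopologicalSpace A]
    [DiscreteTopology A] {X : Set (ℤ → A)} (hX : IsCompact X) {π : (ℤ → A) → Ω}
    (hπ : ContinuousOn π X) {δ : ℝ} (hδ : 0 < δ) :
    ∃ N : ℕ, ∀ x ∈ X, ∀ y ∈ X, (∀ i : ℤ, -N ≤ i → i ≤ N → x i = y i) →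
      dist (π x) (π y) ≤ δ := by
  suffices h : ∃ N : ℕ, ∀ x ∈ X, ∀ y ∈ X, x ∈ X → (∀ i : ℤ, -N ≤ i → i ≤ N → x i = y i) →
      dist (π x) (π y) ≤ δ by
    obtain ⟨N, hN⟩ := h
    exact ⟨N, fun x hx y hy => hN x hx y hy hx⟩
  refine hX.induction_on (p := fun S => ∃ N : ℕ, ∀ x ∈ S, ∀ y ∈ X, x ∈ X →
    (∀ i : ℤ, -N ≤ i → i ≤ N → x i = y i) → dist (π x) (π y) ≤ δ) ?_ ?_ ?_ ?_
  · exact ⟨0, fun x hx => absurd hx (Set.notMem_empty x)⟩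
  · rintro S T hST ⟨N, hN⟩
    exact ⟨N, fun x hx => hN x (hST hx)⟩
  · rintro S T ⟨N, hN⟩ ⟨M, hM⟩
    refine ⟨max N M, fun x hx y hy hxX hxy => ?_⟩
    rcases hx with hx | hx
    · exact hN x hx y hy hxX fun i h1 h2 => hxy i (by omega) (by omega)
    · exact hM x hx y hy hxX fun i h1 h2 => hxy i (by omega) (by omega)
  · intro x hx
    have hnhds : 𝓝 x = Filter.pi fun i => pure (x i) := by simp [nhds_pi, nhds_discrete]
    have h1 : {y | dist (π y) (π x) < δ / 2} ∈ 𝓝[X] x :=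
      (hπ x hx).eventually (Metric.ball_mem_nhds _ (half_pos hδ))
    rw [mem_nhdsWithin_iff_exists_mem_nhds_inter, hnhds] at h1
    obtain ⟨u, hu, huX⟩ := h1
    obtain ⟨I, hI, hIu⟩ := Filter.mem_pi_pure.1 hu
    obtain ⟨N, hN⟩ : ∃ N : ℕ, ∀ i ∈ I, i.natAbs ≤ N := by
      obtain ⟨N, hN⟩ := (hI.image Int.natAbs).bddAbove
      exact ⟨N, fun i hi => hN ⟨i, hi, rfl⟩⟩
    refine ⟨{z | ∀ i ∈ I, z i = x i}, mem_nhdsWithin_of_mem_nhds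
      (hnhds ▸ Filter.mem_pi_pure.2 ⟨I, hI, fun _ h => h⟩), N, fun z hz y hy hzX hzy => ?_⟩
    have hz' : dist (π z) (π x) < δ / 2 := huX ⟨hIu z hz, hzX⟩
    have hy' : dist (π y) (π x) < δ / 2 := huX ⟨hIu y fun i hi => by
      have := hN i hi
      rw [← hz i hi, hzy i (by omega) (by omega)], hy⟩
    linarith [dist_triangle_right (π z) (π y) (π x)]

/-- A finitely presented system has a coding over a finite alphabet. -/
lemma IsFPSystem.exists_coding {Ω : Type*} [MetricSpace Ω] [CompactSpace Ω] {f : Ω ≃ₜ Ω}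
    (hf : IsFPSystem f) :
    ∃ (A : Type) (_ : Finite A) (R W : A → A → Prop) (π : (ℤ → A) → Ω),
      IsCoding f.toEquiv R W π := by
  obtain ⟨⟨ε, hε, hexp⟩, m, X, π, ⟨R', hXR⟩, hcont, hsurj, hshift⟩ := hf
  set R : Fin m → Fin m → Prop := fun a b => (a, b) ∈ R' with hR
  have hX : X = biPaths R := hXR
  subst hX
  have hclosed : IsClosed (biPaths R) := by
    have : biPaths R = ⋂ i : ℤ, (fun x : ℤ → Fin m => (x i, x (i + 1))) ⁻¹' R' := by
      ext x; simp [biPaths, hR]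
    rw [this]
    exact isClosed_iInter fun i => (isClosed_discrete R').preimage (by fun_prop)
  obtain ⟨N, hN⟩ := exists_window hclosed.isCompact hcont (half_pos hε)
  have hπ := map_shift_zpow (g := f.toEquiv) (π := π) hshift
  -- recode by blocks of length `2 * N + 1`
  let block : (ℤ → Fin m) → ℤ → Fin (2 * N + 1) → Fin m := fun x i j => x (i + (j : ℕ))
  let S : (Fin (2 * N + 1) → Fin m) → (Fin (2 * N + 1) → Fin m) → Prop := fun a b =>
    ∃ x ∈ biPaths R, a = block x 0 ∧ b = block x 1
  let dec : (ℤ → Fin (2 * N + 1) → Fin m) → ℤ → Fin m := fun u i => u i 0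
  have hblock : ∀ x ∈ biPaths R, block x ∈ biPaths S := fun x hx i =>
    ⟨_, biPaths_shift hx i, by
      ext j; simp only [block]; congr 2; ring, by
      ext j; simp only [block]; congr 2; ring⟩
  have hdec : ∀ u ∈ biPaths S, dec u ∈ biPaths R := by
    intro u hu i
    obtain ⟨x, hx, h0, h1⟩ := hu i
    simpa [dec, h0, h1, block] using hx 0
  have hdecb : ∀ u ∈ biPaths S, ∀ (i : ℤ) (j : Fin (2 * N + 1)), u i j = dec u (i + (j : ℕ)) := by
    intro u hu i j
    obtain ⟨j, hj⟩ := j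
    induction j generalizing i with
    | zero => simp [dec]
    | succ j ih =>
      obtain ⟨x, hx, h0, h1⟩ := hu i
      have := ih (i + 1) (by omega)
      rw [h1] at this
      rw [h0]
      simp only [block] at this ⊢
      push_cast at this ⊢
      rw [show (0 : ℤ) + (j + 1) = 1 + j by ring, this]
      congr 1; ring
  let ρ : (ℤ → Fin (2 * N + 1) → Fin m) → Ω := fun u => π (fun i => dec u (i + N))
  have hρ : ∀ u ∈ biPaths S, ∀ k : ℤ, ρ (fun i => u (i + k)) = (f.toEquiv ^ k) (ρ u) := by
    intro u hu k
    simp only [ρ]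
    rw [← hπ _ (biPaths_shift (hdec u hu) N)]
    simp only [dec, add_right_comm]
  have hloc : ∀ u ∈ biPaths S, ∀ v ∈ biPaths S, u 0 = v 0 → dist (ρ u) (ρ v) ≤ ε / 2 := by
    intro u hu v hv huv
    refine hN _ (biPaths_shift (hdec u hu) N) _ (biPaths_shift (hdec v hv) N) fun i h1 h2 => ?_
    have e := congrFun huv ⟨(i + N).toNat, by omega⟩
    rw [hdecb u hu, hdecb v hv] at e
    simpa [Int.toNat_of_nonneg (show 0 ≤ i + N by omega)] using e
  refine ⟨Fin (2 * N + 1) → Fin m, inferInstance, S,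
    fun a b => ∃ u ∈ biPaths S, ∃ v ∈ biPaths S, ρ u = ρ v ∧ u 0 = a ∧ v 0 = b, ρ, hρ, ?_, ?_⟩
  · intro u hu v hv
    constructor
    · intro e i
      refine ⟨_, biPaths_shift hu i, _, biPaths_shift hv i, ?_, by simp, by simp⟩
      rw [hρ u hu, hρ v hv, e]
    · intro h
      by_contra hne
      obtain ⟨i, hi⟩ := hexp _ _ hne
      obtain ⟨u', hu', v', hv', e, hu0, hv0⟩ := h i
      rw [← hρ u hu, ← hρ v hv] at hi
      have h1 := hloc _ (biPaths_shift hu i) u' hu' (by simp [hu0])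
      have h2 := hloc v' hv' _ (biPaths_shift hv i) (by simp [hv0])
      rw [← e] at h2
      have := dist_triangle (ρ fun j => u (j + i)) (ρ u') (ρ fun j => v (j + i))
      linarith
  · intro ω
    obtain ⟨x, hx, rfl⟩ : ω ∈ π '' biPaths R := hsurj ▸ Set.mem_univ ω
    refine ⟨_, hblock _ (biPaths_shift hx (-N)), ?_⟩
    simp [ρ, dec, block]

end Window

/-- The least period set of a finitely presented system is a union of a finite set and
finitely many sets of the form `dᵢ Sᵢ` with `Sᵢ` cofinite in `ℕ = {1, 2, ...}`, and it
is nonempty. -/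
theorem LPS_of_FP {Ω : Type*} [MetricSpace Ω] [CompactSpace Ω] [Nonempty Ω]
    (f : Ω ≃ₜ Ω) (hFP : IsFPSystem f) :
    ∃ (F : Finset ℕ) (n : ℕ) (d : Fin n → ℕ) (S : Fin n → Set ℕ),
      (∀ m ∈ F, 0 < m) ∧ (∀ i, 0 < d i) ∧ (∀ i, CofinitePos (S i)) ∧
      leastPeriodSet (⇑f) = ↑F ∪ ⋃ i : Fin n, (fun s => d i * s) '' S i ∧
      leastPeriodSet (⇑f) ≠ ∅ := by
  classical
  obtain ⟨A₀, _, R₀, W₀, π₀, h₀⟩ := hFP.exists_coding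
  obtain ⟨W, π, h, hlift⟩ := h₀.exists_clique_coding
  set R := CliqueStep R₀ W₀
  let d : Set A₀ → ℕ := fun v => Nat.setGcd (loopLengths R v : Set ℕ)
  let D := {v : Set A₀ // 0 < d v ∧ ∃ M, ∀ m ≥ M, d v ∣ m → m ∈ leastPeriodSet (⇑f)}
  obtain ⟨n, ⟨e⟩⟩ := Finite.exists_equiv_fin D
  have hpos : ∀ m ∈ leastPeriodSet (⇑f), 0 < m := fun m hm => hm.1
  refine ⟨(Finset.Icc 0 (Nat.card (Set A₀))).filter (· ∈ leastPeriodSet (⇑f)), n,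
    fun i => d (e.symm i).1, fun i => {s | d (e.symm i).1 * s ∈ leastPeriodSet (⇑f)},
    fun m hm => hpos m (Finset.mem_filter.1 hm).2, fun i => (e.symm i).2.1, fun i => ⟨?_, ?_⟩,
    ?_, h.leastPeriodSet_nonempty.ne_empty⟩
  · intro s hs
    exact Nat.pos_of_mul_pos_left (hpos _ hs)
  · obtain ⟨h0, M, hM⟩ := (e.symm i).2
    refine (Set.finite_lt_nat M).subset fun s hs => ?_
    by_contra hsM
    refine hs.2 (hM _ ?_ (dvd_mul_right _ _))
    exact (not_lt.1 hsM).trans (Nat.le_mul_of_pos_left s h0)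
  · ext m
    simp only [Set.mem_union, Finset.coe_filter, Finset.mem_Icc, Set.mem_ofPred_eq, Set.mem_iUnion,
      Set.mem_image]
    constructor
    · intro hm
      rcases le_or_gt m (Nat.card (Set A₀)) with hle | hlt
      · exact Or.inl ⟨⟨Nat.zero_le m, hle⟩, hm⟩
      · right
        obtain ⟨-, ω, hω⟩ := mem_leastPeriodSet_iff.1 hm
        obtain ⟨x, hx, rfl, hxm⟩ := hlift m ω (hω ▸ iterate_minimalPeriod)
        obtain ⟨v, ⟨s, rfl⟩, hv⟩ := h.exists_loop_gcd hx hxm hω hlt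
        refine ⟨e ⟨v, hv⟩, s, ?_, ?_⟩ <;> simp only [Equiv.symm_apply_apply]
        · exact hm
        · rfl
    · rintro (⟨-, hm⟩ | ⟨i, s, hs, rfl⟩)
      exacts [hm, hs]
end
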